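/- Let m ≥ 2 be an integer with 6 ∣ m and set r := ⌊(m−1)/6⌋. For any cyclic urn process (R_n)_{n≥0} with m types started with one ball of type 0, there exist complex-valued random variables Ξ_1, …, Ξ_r on the same probability space such that, as n → ∞, the random vectors (1/√(n log n))·(R_n − E[R_n] − Σ_{k=1}^r 2·Re(n^{ω^k} Ξ_k v_k)) converge in distribution to the centered Gaussian distribution 𝒩(0, Σ^{(m)}) on ℝ^m, where Σ^{(m)} := v_{m/6} v_{m/6}* + v_{5m/6} v_{5m/6}*. Moreover Σ^{(m)} is a real symmetric positive semidefinite matrix of rank 2. -/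

import Mathlib

open MeasureTheory ProbabilityTheory Filter Complex Finset Topology

noncomputable section

/-- `ω = exp(2πi/m)`, the `m`-th elementary root of unity. -/
def cw (m : ℕ) : ℂ := Complex.exp (2 * Real.pi * Complex.I / m)

/-- `λ_k = cos(2πk/m)`. -/
def lam (m k : ℕ) : ℝ := Real.cos (2 * Real.pi * k / m)

/-- `μ_k = sin(2πk/m)`. -/
def muim (m k : ℕ) : ℝ := Real.sin (2 * Real.pi * k / m)

/-- the eigenvector `v_k = (1/m)(1, ω^{-k}, …, ω^{-(m-1)k})`. -/
def vvec (m k : ℕ) : Fin m → ℂ :=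
  fun t => (m : ℂ)⁻¹ * cw m ^ (-((k * (t : ℕ) : ℕ) : ℤ))

/-- the dual coefficient `u_k(w) = ∑_t ω^{kt} w_t`. -/
def ucoef (m k : ℕ) (w : Fin m → ℝ) : ℂ :=
  ∑ t : Fin m, cw m ^ (k * (t : ℕ)) * (w t : ℂ)

/-- the replacement matrix `A` of the cyclic urn. -/
def repA (m : ℕ) : Matrix (Fin m) (Fin m) ℝ :=
  Matrix.of fun i j => if (j : ℕ) = ((i : ℕ) + 1) % m then 1 else 0

/-- the filtration `𝓕_n = σ(R_0, …, R_n)`. -/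
def urnFilt {Ω : Type*} [MeasurableSpace Ω] (m : ℕ) (R : ℕ → Ω → Fin m → ℝ) (n : ℕ) :
    MeasurableSpace Ω :=
  ⨆ i ∈ Finset.range (n + 1), MeasurableSpace.comap (R i) inferInstance

/-- A cyclic urn process with `m` types started with one ball of type `j0`. -/
structure IsCyclicUrn {Ω : Type*} [MeasurableSpace Ω] (μ : Measure Ω) (m : ℕ) (j0 : Fin m)
    (R : ℕ → Ω → Fin m → ℝ) : Prop where
  isProb : IsProbabilityMeasure μ
  meas : ∀ n, Measurable (R n)
  natVal : ∀ n ω i, ∃ z : ℕ, R n ω i = z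
  init : ∀ ω, R 0 ω = fun i => if i = j0 then 1 else 0
  step : ∀ n, ∀ j : Fin m,
    μ[Set.indicator {ω | R (n + 1) ω =
        fun i => R n ω i + if (i : ℕ) = ((j : ℕ) + 1) % m then 1 else 0}
      (fun _ => (1 : ℝ)) | urnFilt m R n]
      =ᵐ[μ] fun ω => R n ω j / (n + 1)

/-- componentwise expectation `E[X]` of a random vector. -/
def expVec {Ω : Type*} [MeasurableSpace Ω] (μ : Measure Ω) {m : ℕ}
    (X : Ω → Fin m → ℝ) : Fin m → ℝ := fun i => ∫ ω, X ω i ∂μ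

/-- the martingale `M_{k,n} = (Γ(n+1)/Γ(n+1+ω^k)) u_k(R_n - E[R_n])`, with `M_{k,0} = 0`. -/
def Mart {Ω : Type*} [MeasurableSpace Ω] (μ : Measure Ω) (m k : ℕ)
    (R : ℕ → Ω → Fin m → ℝ) (n : ℕ) (ω : Ω) : ℂ :=
  if n = 0 then 0
  else (Complex.Gamma ((n : ℂ) + 1) / Complex.Gamma ((n : ℂ) + 1 + cw m ^ k)) *
    ucoef m k (fun t => R n ω t - expVec μ (R n) t)

/-- `ν` is the centered Gaussian distribution `𝒩(0, S)` on `ℝ^d` (Cramér–Wold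
characterization: every linear functional is one-dimensional centered Gaussian). -/
def IsCenteredGaussian {d : ℕ} (ν : Measure (Fin d → ℝ)) (S : Matrix (Fin d) (Fin d) ℝ) : Prop :=
  IsProbabilityMeasure ν ∧
  ∀ l : Fin d → ℝ,
    ν.map (fun x => ∑ i, l i * x i) =
      gaussianReal 0 (Real.toNNReal (∑ i, ∑ j, l i * S i j * l j))

/-- convergence in distribution of the random vectors `X_n` to the law `ν`. -/
def TendstoInDist {Ω : Type*} [MeasurableSpace Ω] (μ : Measure Ω) {d : ℕ}
    (X : ℕ → Ω → Fin d → ℝ) (ν : Measure (Fin d → ℝ)) : Prop :=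
  ∀ f : BoundedContinuousFunction (Fin d → ℝ) ℝ,
    Tendsto (fun n => ∫ ω, f (X n ω) ∂μ) atTop (𝓝 (∫ x, f x ∂ν))


/-- the complex matrix `Σ^{(m)} = v_{m/6} v_{m/6}^* + v_{5m/6} v_{5m/6}^*`. -/
def cSigmaB (m : ℕ) : Matrix (Fin m) (Fin m) ℂ :=
  Matrix.of fun i j => vvec m (m / 6) i * star (vvec m (m / 6) j) +
    vvec m (5 * m / 6) i * star (vvec m (5 * m / 6) j)

/-- the real matrix `Σ^{(m)}` (real part of `cSigmaB`). -/
def rSigmaB (m : ℕ) : Matrix (Fin m) (Fin m) ℝ :=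
  Matrix.of fun i j => (cSigmaB m i j).re

/-- the basis vector added to the urn when a ball of type `j` is drawn. -/
def drawVec (m : ℕ) (j : Fin m) : Fin m → ℝ :=
  fun i => if (i : ℕ) = ((j : ℕ) + 1) % m then 1 else 0

lemma drawVec_injective (m : ℕ) : Function.Injective (drawVec m) := by
  intro a b hab
  have hm : 0 < m := a.pos
  have h := congrFun hab ⟨((a : ℕ) + 1) % m, Nat.mod_lt _ hm⟩
  simp only [drawVec, if_true] at h
  have h2 : ((a : ℕ) + 1) % m = ((b : ℕ) + 1) % m := by
    by_contra hne
    simp [hne] at h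
  have h3 : (a : ℕ) ≡ b [MOD m] := Nat.ModEq.add_right_cancel' 1 h2
  exact Fin.ext (by
    have := h3
    rwa [Nat.ModEq, Nat.mod_eq_of_lt a.2, Nat.mod_eq_of_lt b.2] at this)

lemma sum_drawVec_mul {𝕜 : Type*} [NonAssocSemiring 𝕜] (m : ℕ) (j : Fin m) (f : ℕ → 𝕜) :
    ∑ i : Fin m, f i * (if (i : ℕ) = ((j : ℕ) + 1) % m then 1 else 0) = f (((j : ℕ) + 1) % m) := by
  rw [Finset.sum_eq_single ⟨((j : ℕ) + 1) % m, Nat.mod_lt _ j.pos⟩]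
  · simp
  · intro b _ hb
    have : (b : ℕ) ≠ ((j : ℕ) + 1) % m := fun h => hb (Fin.ext h)
    simp [this]
  · simp

lemma sum_drawVec (m : ℕ) (j : Fin m) : ∑ i, drawVec m j i = 1 := by
  simpa [drawVec] using sum_drawVec_mul m j (fun _ => (1 : ℝ))

section Urn

variable {Ω : Type*} [mΩ : MeasurableSpace Ω] {μ : Measure Ω} {m : ℕ} {j0 : Fin m}
  {R : ℕ → Ω → Fin m → ℝ}

lemma urnFilt_le (hR : IsCyclicUrn μ m j0 R) (n : ℕ) : urnFilt m R n ≤ mΩ := by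
  unfold urnFilt
  exact iSup₂_le fun i _ => (hR.meas i).comap_le

lemma measurable_urnFilt {k n : ℕ} (hk : k ≤ n) : Measurable[urnFilt m R n] (R k) := by
  rw [measurable_iff_comap_le]
  exact le_iSup₂_of_le (f := fun i (_ : i ∈ Finset.range (n + 1)) =>
    MeasurableSpace.comap (R i) inferInstance) k (by simp; omega) le_rfl

/-- the event that a ball of type `j` is drawn in step `n`. -/
def drawEvent (R : ℕ → Ω → Fin m → ℝ) (n : ℕ) (j : Fin m) : Set Ω :=
  {ω | R (n + 1) ω = fun i => R n ω i + drawVec m j i}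

lemma measurableSet_drawEvent (hR : IsCyclicUrn μ m j0 R) (n : ℕ) (j : Fin m) :
    MeasurableSet (drawEvent R n j) := by
  have h1 := hR.meas n
  exact measurableSet_eq_fun (hR.meas (n + 1)) (by fun_prop)

lemma drawEvent_disjoint (n : ℕ) {i j : Fin m} (hij : i ≠ j) {ω : Ω}
    (hi : ω ∈ drawEvent R n i) : ω ∉ drawEvent R n j := by
  intro hj
  apply hij
  apply drawVec_injective m
  have h : (fun t => R n ω t + drawVec m i t) = fun t => R n ω t + drawVec m j t :=
    hi.symm.trans hj
  ext t
  simpa using congrFun h t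

lemma urn_nonneg (hR : IsCyclicUrn μ m j0 R) (n : ℕ) (ω : Ω) (i : Fin m) : 0 ≤ R n ω i := by
  obtain ⟨z, hz⟩ := hR.natVal n ω i
  rw [hz]
  positivity

lemma condExp_drawEvent (hR : IsCyclicUrn μ m j0 R) (n : ℕ) (j : Fin m) :
    μ[(drawEvent R n j).indicator (fun _ => (1 : ℝ)) | urnFilt m R n]
      =ᵐ[μ] fun ω => R n ω j / (n + 1) := hR.step n j

lemma exists_draw_of_sum (hR : IsCyclicUrn μ m j0 R) (n : ℕ)
    (hsum : ∀ᵐ ω ∂μ, ∑ i, R n ω i = n + 1) :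
    ∀ᵐ ω ∂μ, ∃ j, ω ∈ drawEvent R n j := by
  have := hR.isProb
  have hint : ∀ j, Integrable ((drawEvent R n j).indicator (fun _ => (1 : ℝ))) μ := fun j =>
    (integrable_const 1).indicator (measurableSet_drawEvent hR n j)
  have hle : ∀ ω, ∑ j, (drawEvent R n j).indicator (fun _ => (1 : ℝ)) ω ≤ 1 := by
    intro ω
    by_cases h : ∃ j, ω ∈ drawEvent R n j
    · obtain ⟨j, hj⟩ := h
      rw [Finset.sum_eq_single j]
      · simp [hj]
      · intro b _ hb
        simp [drawEvent_disjoint n (Ne.symm hb) hj]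
      · simp
    · push Not at h
      simp [h]
  have htot : ∫ ω, ∑ j, (drawEvent R n j).indicator (fun _ => (1 : ℝ)) ω ∂μ = 1 := by
    have hRint : ∀ j, Integrable (fun ω => R n ω j / (n + 1)) μ := fun j =>
      integrable_condExp.congr (condExp_drawEvent hR n j)
    rw [integral_finsetSum _ (fun j _ => hint j)]
    calc _ = ∑ j, ∫ ω, R n ω j / (n + 1) ∂μ := by
          refine Finset.sum_congr rfl fun j _ => ?_
          rw [← integral_condExp (urnFilt_le hR n)]
          exact integral_congr_ae (condExp_drawEvent hR n j)
      _ = ∫ ω, ∑ j, R n ω j / (n + 1) ∂μ := (integral_finsetSum _ fun j _ => hRint j).symm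
      _ = ∫ ω, 1 ∂μ := by
          refine integral_congr_ae ?_
          filter_upwards [hsum] with ω hω
          rw [← Finset.sum_div, hω]
          exact div_self (by positivity)
      _ = 1 := by simp
  have hzero : (fun ω => 1 - ∑ j, (drawEvent R n j).indicator (fun _ => (1 : ℝ)) ω) =ᵐ[μ] 0 := by
    rw [← integral_eq_zero_iff_of_nonneg (fun ω => sub_nonneg.2 (hle ω))
      ((integrable_const _).sub (integrable_finsetSum _ fun j _ => hint j)),
      integral_sub (integrable_const _) (integrable_finsetSum _ fun j _ => hint j), htot]
    simp
  filter_upwards [hzero] with ω hω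
  by_contra h
  push Not at h
  simp [h] at hω

lemma urn_sum (hR : IsCyclicUrn μ m j0 R) (n : ℕ) : ∀ᵐ ω ∂μ, ∑ i, R n ω i = n + 1 := by
  induction n with
  | zero => exact Eventually.of_forall fun ω => by simp [hR.init]
  | succ n ih =>
    filter_upwards [ih, exists_draw_of_sum hR n ih] with ω h1 ⟨j, hj⟩
    rw [show R (n + 1) ω = _ from hj, Finset.sum_add_distrib, h1, sum_drawVec]
    push_cast
    ring

lemma urn_exists_draw (hR : IsCyclicUrn μ m j0 R) (n : ℕ) :
    ∀ᵐ ω ∂μ, ∃ j, ω ∈ drawEvent R n j :=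
  exists_draw_of_sum hR n (urn_sum hR n)

lemma urn_mem_Icc (hR : IsCyclicUrn μ m j0 R) (n : ℕ) :
    ∀ᵐ ω ∂μ, R n ω ∈ Set.Icc (0 : Fin m → ℝ) (fun _ => (n : ℝ) + 1) := by
  filter_upwards [urn_sum hR n] with ω hω
  refine ⟨fun i => urn_nonneg hR n ω i, fun i => ?_⟩
  rw [← hω]
  exact Finset.single_le_sum (f := R n ω) (fun i _ => urn_nonneg hR n ω i) (Finset.mem_univ i)

variable {E : Type*} [NormedAddCommGroup E] [NormedSpace ℝ E]

lemma urn_integrable_pair (hR : IsCyclicUrn μ m j0 R) (k n : ℕ)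
    {G : (Fin m → ℝ) × (Fin m → ℝ) → E} (hG : Continuous G) :
    Integrable (fun ω => G (R k ω, R n ω)) μ := by
  have := hR.isProb
  have hc : IsCompact (Set.Icc (0 : Fin m → ℝ) (fun _ => (k : ℝ) + 1) ×ˢ
      Set.Icc (0 : Fin m → ℝ) (fun _ => (n : ℝ) + 1)) := isCompact_Icc.prod isCompact_Icc
  obtain ⟨C, hC⟩ := hc.exists_bound_of_continuousOn hG.continuousOn
  have hmeas : Measurable fun ω => (R k ω, R n ω) := (hR.meas k).prodMk (hR.meas n)
  refine Integrable.of_bound (hG.stronglyMeasurable.comp_measurable hmeas).aestronglyMeasurable C ?_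
  filter_upwards [urn_mem_Icc hR k, urn_mem_Icc hR n] with ω h1 h2
  exact hC _ ⟨h1, h2⟩

lemma urn_integrable (hR : IsCyclicUrn μ m j0 R) (n : ℕ)
    {G : (Fin m → ℝ) → E} (hG : Continuous G) :
    Integrable (fun ω => G (R n ω)) μ :=
  urn_integrable_pair hR n n (G := fun p => G p.1) (by fun_prop)

/-- The Markov property of the urn, tested against continuous functions. -/
lemma urn_integral_succ_pair [CompleteSpace E] (hR : IsCyclicUrn μ m j0 R) {k n : ℕ} (hk : k ≤ n)
    {G : (Fin m → ℝ) × (Fin m → ℝ) → E} (hG : Continuous G) :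
    ∫ ω, G (R k ω, R (n + 1) ω) ∂μ =
      ∫ ω, ∑ j, (R n ω j / (n + 1)) • G (R k ω, fun i => R n ω i + drawVec m j i) ∂μ := by
  have := hR.isProb
  have hGj : ∀ j, Integrable (fun ω => G (R k ω, fun i => R n ω i + drawVec m j i)) μ := fun j =>
    urn_integrable_pair hR k n (G := fun p => G (p.1, fun i => p.2 i + drawVec m j i))
      (by fun_prop)
  have hind : ∀ j, Integrable ((drawEvent R n j).indicator (fun _ => (1 : ℝ))) μ := fun j =>
    (integrable_const 1).indicator (measurableSet_drawEvent hR n j)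
  have hsm : ∀ j ω, ((drawEvent R n j).indicator (fun _ => (1 : ℝ)) •
      fun ω => G (R k ω, fun i => R n ω i + drawVec m j i)) ω =
      (drawEvent R n j).indicator (fun ω => G (R k ω, fun i => R n ω i + drawVec m j i)) ω := by
    intro j ω
    by_cases h : ω ∈ drawEvent R n j <;> simp [h]
  have hprod : ∀ j, Integrable ((drawEvent R n j).indicator (fun _ => (1 : ℝ)) •
      fun ω => G (R k ω, fun i => R n ω i + drawVec m j i)) μ := fun j =>
    ((hGj j).indicator (measurableSet_drawEvent hR n j)).congr
      (Eventually.of_forall fun ω => (hsm j ω).symm)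
  have hpull : ∀ j, μ[(drawEvent R n j).indicator (fun _ => (1 : ℝ)) •
      (fun ω => G (R k ω, fun i => R n ω i + drawVec m j i)) | urnFilt m R n] =ᵐ[μ]
      fun ω => (R n ω j / (n + 1)) • G (R k ω, fun i => R n ω i + drawVec m j i) := by
    intro j
    have hmeas : Measurable[urnFilt m R n] fun ω => (R k ω, fun i => R n ω i + drawVec m j i) := by
      have h1 := measurable_urnFilt (R := R) hk
      have h2 := measurable_urnFilt (R := R) (le_refl n)
      refine h1.prodMk ?_
      exact (measurable_add_const (drawVec m j)).comp h2
    have hstr : AEStronglyMeasurable[urnFilt m R n]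
        (fun ω => G (R k ω, fun i => R n ω i + drawVec m j i)) μ :=
      (hG.stronglyMeasurable.comp_measurable hmeas).aestronglyMeasurable
    filter_upwards [condExp_smul_of_aestronglyMeasurable_right (hind j) (hprod j) hstr,
      condExp_drawEvent hR n j] with ω h1 h2
    rw [h1, Pi.smul_apply', h2]
  calc ∫ ω, G (R k ω, R (n + 1) ω) ∂μ
      = ∫ ω, ∑ j, ((drawEvent R n j).indicator (fun _ => (1 : ℝ)) •
          fun ω => G (R k ω, fun i => R n ω i + drawVec m j i)) ω ∂μ := by
        refine integral_congr_ae ?_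
        filter_upwards [urn_exists_draw hR n] with ω ⟨j, hj⟩
        rw [Finset.sum_eq_single j]
        · rw [hsm, Set.indicator_of_mem hj, show R (n + 1) ω = _ from hj]
        · intro b _ hb
          rw [hsm, Set.indicator_of_notMem (drawEvent_disjoint n (Ne.symm hb) hj)]
        · simp
    _ = ∑ j, ∫ ω, ((drawEvent R n j).indicator (fun _ => (1 : ℝ)) •
          fun ω => G (R k ω, fun i => R n ω i + drawVec m j i)) ω ∂μ :=
        integral_finsetSum _ fun j _ => hprod j
    _ = ∑ j, ∫ ω, (R n ω j / (n + 1)) • G (R k ω, fun i => R n ω i + drawVec m j i) ∂μ := by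
        refine Finset.sum_congr rfl fun j _ => ?_
        rw [← integral_condExp (urnFilt_le hR n)]
        exact integral_congr_ae (hpull j)
    _ = _ := by
        rw [integral_finsetSum]
        exact fun j _ => integrable_condExp.congr (hpull j)

lemma urn_integral_succ [CompleteSpace E] (hR : IsCyclicUrn μ m j0 R) (n : ℕ)
    {G : (Fin m → ℝ) → E} (hG : Continuous G) :
    ∫ ω, G (R (n + 1) ω) ∂μ =
      ∫ ω, ∑ j, (R n ω j / (n + 1)) • G (fun i => R n ω i + drawVec m j i) ∂μ :=
  urn_integral_succ_pair hR le_rfl (G := fun p => G p.2) (by fun_prop)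

end Urn

/-- the growth factor `∏_{j=1}^n (1 + z/j)`. -/
def urnProd (z : ℂ) (n : ℕ) : ℂ := ∏ j ∈ Finset.range n, (1 + z / ((j : ℂ) + 1))

@[simp] lemma urnProd_zero (z : ℂ) : urnProd z 0 = 1 := by simp [urnProd]

lemma urnProd_succ (z : ℂ) (n : ℕ) :
    urnProd z (n + 1) = urnProd z n * (1 + z / ((n : ℂ) + 1)) := by
  simp [urnProd, Finset.prod_range_succ]

lemma one_add_div_ne_zero {z : ℂ} (hz : 0 < z.re) (n : ℕ) : 1 + z / ((n : ℂ) + 1) ≠ 0 := by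
  intro h
  have h1 : (1 + z / ((n : ℂ) + 1)).re = 1 + z.re / (n + 1) := by
    have : ((n : ℂ) + 1) = ((n + 1 : ℝ) : ℂ) := by push_cast; rfl
    rw [this, add_re, div_ofReal_re, one_re]
  rw [h, zero_re] at h1
  have : 0 < z.re / (n + 1) := by positivity
  linarith

lemma urnProd_ne_zero {z : ℂ} (hz : 0 < z.re) (n : ℕ) : urnProd z n ≠ 0 :=
  Finset.prod_ne_zero_iff.2 fun j _ => one_add_div_ne_zero hz j

lemma cpow_div_urnProd {z : ℂ} (hz : 0 < z.re) (n : ℕ) :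
    (n : ℂ) ^ z / urnProd z n = z * Complex.GammaSeq z n := by
  have hz0 : z ≠ 0 := fun h => by simp [h] at hz
  have key : ∏ j ∈ Finset.range (n + 1), (z + j) = z * n.factorial * urnProd z n := by
    induction n with
    | zero => simp
    | succ n ih =>
      rw [Finset.prod_range_succ, ih, urnProd_succ, Nat.factorial_succ]
      have : ((n : ℂ) + 1) ≠ 0 := by exact_mod_cast Nat.succ_ne_zero n
      push_cast
      field_simp
      ring
  have hf : (n.factorial : ℂ) ≠ 0 := by exact_mod_cast Nat.factorial_ne_zero n
  have hu := urnProd_ne_zero hz n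
  rw [Complex.GammaSeq, key]
  field_simp

lemma norm_ratio_sub_one_le {z : ℂ} (hz : ‖z‖ ≤ 1) {n : ℕ} (hn : 1 ≤ n) :
    ‖(1 + z / ((n : ℂ) + 1)) * exp (-z * (Real.log (n + 1) - Real.log n : ℝ)) - 1‖
      ≤ 6 * (1 / (n : ℝ) - 1 / (n + 1)) := by
  set L : ℝ := Real.log (n + 1) - Real.log n with hL
  have hn0 : (0 : ℝ) < n := by exact_mod_cast hn
  have hn1 : (1 : ℝ) ≤ n := by exact_mod_cast hn
  have hLeq : L = Real.log ((n + 1) / n) := by rw [Real.log_div (by positivity) hn0.ne']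
  have hLu : L ≤ 1 / n := by
    rw [hLeq]
    refine (Real.log_le_sub_one_of_pos (by positivity)).trans (le_of_eq ?_)
    field_simp
    ring
  have hLl : 1 / ((n : ℝ) + 1) ≤ L := by
    rw [hLeq]
    refine le_trans (le_of_eq ?_) (Real.one_sub_inv_le_log_of_pos (by positivity))
    field_simp
    ring
  have hL0 : 0 ≤ L := le_trans (by positivity) hLl
  have hL1 : L ≤ 1 := hLu.trans (by rw [div_le_one hn0]; exact hn1)
  set x : ℝ := 1 / ((n : ℝ) + 1) with hx
  have hx0 : 0 ≤ x := by positivity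
  have hx1 : x ≤ 1 := by rw [hx, div_le_one (by positivity)]; linarith
  set ε : ℂ := exp (-z * L) - 1 - (-z * L) with hε
  have hzL : ‖-z * (L : ℂ)‖ ≤ L := by
    rw [norm_mul, norm_neg, norm_real, Real.norm_of_nonneg hL0]
    nlinarith
  have hεn : ‖ε‖ ≤ L ^ 2 :=
    (norm_exp_sub_one_sub_id_le (hzL.trans hL1)).trans (by gcongr)
  have hzx : z / ((n : ℂ) + 1) = z * x := by
    rw [hx]; push_cast; ring
  have hdec : (1 + z / ((n : ℂ) + 1)) * exp (-z * L) - 1 =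
      z * ((x - L : ℝ) : ℂ) - z ^ 2 * ((x * L : ℝ) : ℂ) + (1 + z * x) * ε := by
    rw [hzx, hε]; push_cast; ring
  rw [hdec]
  have hd : 1 / (n : ℝ) - x = 1 / (n : ℝ) * x := by rw [hx]; field_simp; ring
  have h1 : ‖z * ((x - L : ℝ) : ℂ)‖ ≤ 1 / (n : ℝ) * x := by
    rw [norm_mul, norm_real, Real.norm_of_nonpos (by linarith)]
    calc ‖z‖ * -(x - L) ≤ 1 * (1 / (n : ℝ) - x) := by
          gcongr <;> linarith
      _ = _ := by rw [one_mul, hd]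
  have h2 : ‖z ^ 2 * ((x * L : ℝ) : ℂ)‖ ≤ 1 / (n : ℝ) * x := by
    rw [norm_mul, norm_pow, norm_real, Real.norm_of_nonneg (by positivity)]
    calc ‖z‖ ^ 2 * (x * L) ≤ 1 * (x * (1 / n)) := by
          gcongr
          exact pow_le_one₀ (norm_nonneg _) hz
      _ = _ := by ring
  have h3 : ‖(1 + z * x) * ε‖ ≤ 4 * (1 / (n : ℝ) * x) := by
    have ha : ‖1 + z * (x : ℂ)‖ ≤ 2 := by
      refine (norm_add_le _ _).trans ?_
      rw [norm_one, norm_mul, norm_real, Real.norm_of_nonneg hx0]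
      nlinarith [norm_nonneg z]
    have hxx : 1 / (n : ℝ) ≤ 2 * x := by
      rw [hx, div_le_iff₀ hn0]
      field_simp
      linarith
    rw [norm_mul]
    calc ‖1 + z * (x : ℂ)‖ * ‖ε‖ ≤ 2 * (1 / n) ^ 2 := by
          gcongr
          exact hεn.trans (by gcongr)
      _ ≤ 2 * (1 / n * (2 * x)) := by
          rw [sq]; gcongr
      _ = _ := by ring
  calc _ ≤ ‖z * ((x - L : ℝ) : ℂ)‖ + ‖z ^ 2 * ((x * L : ℝ) : ℂ)‖ + ‖(1 + z * x) * ε‖ :=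
        (norm_add_le _ _).trans (by gcongr; exact norm_sub_le _ _)
    _ ≤ 1 / (n : ℝ) * x + 1 / (n : ℝ) * x + 4 * (1 / (n : ℝ) * x) := by gcongr
    _ = 6 * (1 / (n : ℝ) - x) := by rw [hd]; ring

lemma urnProd_div_cpow_succ {z : ℂ} {n : ℕ} (hn : 1 ≤ n) :
    urnProd z (n + 1) / ((n + 1 : ℕ) : ℂ) ^ z = urnProd z n / (n : ℂ) ^ z *
      ((1 + z / ((n : ℂ) + 1)) * exp (-z * (Real.log (n + 1) - Real.log n : ℝ))) := by
  have hn0 : (n : ℂ) ≠ 0 := by exact_mod_cast (by omega : n ≠ 0)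
  have hn1 : ((n + 1 : ℕ) : ℂ) ≠ 0 := by exact_mod_cast Nat.succ_ne_zero n
  rw [urnProd_succ, cpow_def_of_ne_zero hn0, cpow_def_of_ne_zero hn1, ← natCast_log, ← natCast_log,
    div_mul_eq_mul_div, div_eq_div_iff (exp_ne_zero _) (exp_ne_zero _)]
  have : exp ((Real.log (n : ℝ) : ℂ) * z) = exp (-z * (Real.log (n + 1) - Real.log n : ℝ)) *
      exp ((Real.log ((n + 1 : ℕ) : ℝ) : ℂ) * z) := by
    rw [← exp_add]
    congr 1
    push_cast
    ring
  rw [this]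
  ring

lemma urnProd_asymp {z : ℂ} (hz : 0 < z.re) (hz1 : ‖z‖ ≤ 1) :
    ∃ b : ℂ, b ≠ 0 ∧ ∃ C : ℝ, 0 ≤ C ∧
      ∀ n : ℕ, 1 ≤ n → ‖urnProd z n / (n : ℂ) ^ z - b‖ ≤ C / n := by
  have hz0 : z ≠ 0 := fun h => by simp [h] at hz
  have hΓ : z * Complex.Gamma z ≠ 0 := mul_ne_zero hz0 (Complex.Gamma_ne_zero_of_re_pos hz)
  set b : ℕ → ℂ := fun n => urnProd z n / (n : ℂ) ^ z with hb
  have hlim : Tendsto b atTop (𝓝 (z * Complex.Gamma z)⁻¹) := by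
    have h := ((Complex.GammaSeq_tendsto_Gamma z).const_mul z).inv₀ hΓ
    refine h.congr fun n => ?_
    rw [← cpow_div_urnProd hz, inv_div]
  obtain ⟨B, hB⟩ := hlim.norm.bddAbove_range
  have hB' : ∀ n, ‖b n‖ ≤ B := fun n => hB ⟨n, rfl⟩
  have hB0 : 0 ≤ B := (norm_nonneg _).trans (hB' 0)
  refine ⟨(z * Complex.Gamma z)⁻¹, inv_ne_zero hΓ, B * 6, by positivity, fun n hn => ?_⟩
  have hstep : ∀ n : ℕ, 1 ≤ n → ‖b (n + 1) - b n‖ ≤ B * 6 * (1 / (n : ℝ) - 1 / (n + 1)) := by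
    intro n hn
    have : b (n + 1) - b n = b n * ((1 + z / ((n : ℂ) + 1)) *
        exp (-z * (Real.log (n + 1) - Real.log n : ℝ)) - 1) := by
      simp only [hb]
      rw [urnProd_div_cpow_succ hn]
      ring
    rw [this, norm_mul, mul_assoc]
    exact mul_le_mul (hB' n) (norm_ratio_sub_one_le hz1 hn) (norm_nonneg _) hB0
  have htel : ∀ l : ℕ, ‖b (n + l) - b n‖ ≤ B * 6 * (1 / (n : ℝ) - 1 / (n + l : ℕ)) := by
    intro l
    induction l with
    | zero => simp
    | succ l ih =>
      have h := hstep (n + l) (by omega)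
      calc ‖b (n + (l + 1)) - b n‖ = ‖(b (n + l + 1) - b (n + l)) + (b (n + l) - b n)‖ := by
            rw [sub_add_sub_cancel, ← add_assoc]
        _ ≤ _ := norm_add_le _ _
        _ ≤ _ := add_le_add h ih
        _ = _ := by push_cast; ring
  have hlim2 : Tendsto (fun l => ‖b (n + l) - b n‖) atTop
      (𝓝 ‖(z * Complex.Gamma z)⁻¹ - b n‖) := by
    have : Tendsto (fun l => b (n + l)) atTop (𝓝 (z * Complex.Gamma z)⁻¹) := by
      simpa only [add_comm] using (tendsto_add_atTop_iff_nat n).2 hlim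
    exact (this.sub_const _).norm
  rw [norm_sub_rev]
  refine le_of_tendsto' hlim2 fun l => (htel l).trans ?_
  rw [div_eq_mul_one_div (B * 6)]
  gcongr
  have : (0 : ℝ) ≤ 1 / (n + l : ℕ) := by positivity
  linarith

lemma norm_cw (m : ℕ) : ‖cw m‖ = 1 := by
  have : 2 * (Real.pi : ℂ) * I / m = ((2 * Real.pi / m : ℝ) : ℂ) * I := by push_cast; ring
  rw [cw, this, norm_exp_ofReal_mul_I]

lemma cw_pow_self {m : ℕ} (hm : m ≠ 0) : cw m ^ m = 1 :=
  (Complex.isPrimitiveRoot_exp m hm).pow_eq_one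

lemma cw_pow_re (m k : ℕ) : (cw m ^ k).re = Real.cos (2 * Real.pi * k / m) := by
  have : (k : ℂ) * (2 * (Real.pi : ℂ) * I / m) = ((2 * Real.pi * k / m : ℝ) : ℂ) * I := by
    push_cast; ring
  rw [cw, ← exp_nat_mul, this, exp_ofReal_mul_I_re]

lemma norm_cw_pow (m k : ℕ) : ‖cw m ^ k‖ = 1 := by rw [norm_pow, norm_cw, one_pow]

lemma continuous_ucoef (m k : ℕ) : Continuous (ucoef m k) := by
  unfold ucoef
  fun_prop

lemma ucoef_sub (m k : ℕ) (v w : Fin m → ℝ) :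
    ucoef m k (fun t => v t - w t) = ucoef m k v - ucoef m k w := by
  simp [ucoef, mul_sub, Finset.sum_sub_distrib]

lemma ucoef_add_drawVec (m k : ℕ) (w : Fin m → ℝ) (j : Fin m) :
    ucoef m k (fun i => w i + drawVec m j i) =
      ucoef m k w + cw m ^ k * cw m ^ (k * (j : ℕ)) := by
  have h := sum_drawVec_mul m j (fun i => cw m ^ (k * i))
  have hm : m ≠ 0 := j.pos.ne'
  have h2 : cw m ^ (k * (((j : ℕ) + 1) % m)) = cw m ^ k * cw m ^ (k * (j : ℕ)) := by
    rw [← pow_add, show k + k * (j : ℕ) = ((j : ℕ) + 1) * k by ring, mul_comm k, pow_mul, pow_mul,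
      ← pow_eq_pow_mod _ (cw_pow_self hm)]
  rw [← h2, ← h]
  simp only [ucoef, drawVec, ofReal_add, mul_add, Finset.sum_add_distrib]
  congr 2
  ext i
  split_ifs <;> simp

lemma sum_smul_draw (m k : ℕ) (w : Fin m → ℝ) (s : ℝ) :
    ∑ j, (w j / s) • (cw m ^ k * cw m ^ (k * (j : ℕ))) = cw m ^ k / s * ucoef m k w := by
  rw [ucoef, Finset.mul_sum]
  refine Finset.sum_congr rfl fun j _ => ?_
  rw [real_smul]
  push_cast
  ring

lemma sum_mul_norm_add_sq {ι : Type*} [Fintype ι] (p : ι → ℝ) (hp : ∑ j, p j = 1) (c : ι → ℂ)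
    (Z : ℂ) : ∑ j, p j * ‖Z + c j‖ ^ 2 =
      ‖Z + ∑ j, p j • c j‖ ^ 2 + ∑ j, p j * ‖c j‖ ^ 2 - ‖∑ j, p j • c j‖ ^ 2 := by
  have h1 : ∀ a b : ℂ, ‖a + b‖ ^ 2 = ‖a‖ ^ 2 + ‖b‖ ^ 2 + 2 * (a * (starRingEnd ℂ) b).re := by
    intro a b
    rw [Complex.sq_norm, Complex.sq_norm, Complex.sq_norm, normSq_add]
  simp only [h1, mul_add, Finset.sum_add_distrib, ← Finset.sum_mul, hp, map_sum, Finset.mul_sum,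
    re_sum]
  have : ∀ j, p j * (2 * (Z * (starRingEnd ℂ) (c j)).re) =
      2 * (Z * (starRingEnd ℂ) (p j • c j)).re := by
    intro j
    simp
    ring
  simp only [this]
  ring

/-- Growth of solutions of the variance recursion. -/
lemma le_rpow_of_recursion {s : ℕ → ℝ} {a p : ℝ} (hp1 : 1 ≤ p) (hap : a < p)
    (hs : ∀ n, 0 ≤ s n)
    (hrec : ∀ n : ℕ, s (n + 1) ≤ (1 + a / (n + 1) + 1 / ((n : ℝ) + 1) ^ 2) * s n + 1)
    (hpos : ∀ n : ℕ, 0 ≤ 1 + a / (n + 1) + 1 / ((n : ℝ) + 1) ^ 2) :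
    ∃ K : ℝ, 0 ≤ K ∧ ∀ n : ℕ, s n ≤ K * ((n : ℝ) + 1) ^ p := by
  obtain ⟨N, hN⟩ := exists_nat_gt (2 / (p - a))
  have hpa : 0 < p - a := by linarith
  set K := 2 / (p - a) + ∑ n ∈ Finset.range (N + 1), s n with hK
  have hsum : 0 ≤ ∑ n ∈ Finset.range (N + 1), s n := Finset.sum_nonneg fun n _ => hs n
  have hK0 : 0 ≤ K := by positivity
  have hK2 : 2 / (p - a) ≤ K := by rw [hK]; linarith
  refine ⟨K, hK0, fun n => ?_⟩
  have hone : ∀ n : ℕ, 1 ≤ ((n : ℝ) + 1) ^ p := fun n =>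
    Real.one_le_rpow (by linarith [(Nat.cast_nonneg n : (0 : ℝ) ≤ n)]) (by linarith)
  induction n with
  | zero =>
    have h0 : s 0 ≤ ∑ n ∈ Finset.range (N + 1), s n :=
      Finset.single_le_sum (f := s) (fun n _ => hs n) (by simp)
    have : 0 < 2 / (p - a) := by positivity
    nlinarith [hone 0]
  | succ n ih =>
    rcases le_or_gt (n + 1) N with hn | hn
    · have h0 : s (n + 1) ≤ ∑ n ∈ Finset.range (N + 1), s n :=
        Finset.single_le_sum (f := s) (fun n _ => hs n) (by simp; omega)
      have : 0 < 2 / (p - a) := by positivity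
      nlinarith [hone (n + 1)]
    · set x : ℝ := (n : ℝ) + 1 with hx
      have hx0 : 0 < x := by positivity
      have hxN : 2 / (p - a) < x := by
        refine hN.trans_le ?_
        rw [hx]
        exact_mod_cast (by omega : N ≤ n + 1)
      have hx1 : 1 / x < (p - a) / 2 := by
        rw [div_lt_iff₀ hpa] at hxN
        rw [div_lt_div_iff₀ hx0 two_pos]
        linarith
      have hbern : x ^ p * (1 + p / x) ≤ (x + 1) ^ p := by
        have h := one_add_mul_self_le_rpow_one_add (s := 1 / x) (by
          have : 0 < 1 / x := by positivity
          linarith) hp1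
        have h2 : x + 1 = x * (1 + 1 / x) := by field_simp
        rw [h2, Real.mul_rpow hx0.le (by positivity)]
        gcongr
        refine le_trans (le_of_eq ?_) h
        ring
      have hxp : x ≤ x ^ p := by
        conv_lhs => rw [← Real.rpow_one x]
        exact Real.rpow_le_rpow_of_exponent_le (by rw [hx]; linarith [(Nat.cast_nonneg n : (0 : ℝ) ≤ n)]) hp1
      have hmain : 1 ≤ K * x ^ p * ((p - a - 1 / x) / x) := by
        calc (1 : ℝ) = 2 / (p - a) * x * (((p - a) / 2) / x) := by field_simp
          _ ≤ K * x ^ p * ((p - a - 1 / x) / x) := by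
              gcongr
              linarith
      push_cast
      calc s (n + 1) ≤ (1 + a / x + 1 / x ^ 2) * s n + 1 := hrec n
        _ ≤ (1 + a / x + 1 / x ^ 2) * (K * x ^ p) + K * x ^ p * ((p - a - 1 / x) / x) := by
            gcongr
            exact hpos n
        _ = K * (x ^ p * (1 + p / x)) := by field_simp; ring
        _ ≤ K * (x + 1) ^ p := by gcongr

lemma norm_one_add_div_sq {z : ℂ} (hz : ‖z‖ = 1) (n : ℕ) :
    ‖1 + z / ((n : ℂ) + 1)‖ ^ 2 = 1 + 2 * z.re / (n + 1) + 1 / ((n : ℝ) + 1) ^ 2 := by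
  have h : ((n : ℂ) + 1) = ((n + 1 : ℝ) : ℂ) := by push_cast; rfl
  have hz2 : z.re * z.re + z.im * z.im = 1 := by
    rw [← normSq_apply, ← Complex.sq_norm, hz, one_pow]
  have hn : (n : ℝ) + 1 ≠ 0 := by positivity
  rw [Complex.sq_norm, normSq_apply, h, add_re, add_im, div_ofReal_re, div_ofReal_im, one_re, one_im]
  field_simp
  nlinarith

section Urn

variable {Ω : Type*} [mΩ : MeasurableSpace Ω] {μ : Measure Ω} {m : ℕ} {j0 : Fin m}
  {R : ℕ → Ω → Fin m → ℝ}

lemma ucoef_init (hR : IsCyclicUrn μ m j0 R) (hj : (j0 : ℕ) = 0) (k : ℕ) (ω : Ω) :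
    ucoef m k (R 0 ω) = 1 := by
  rw [hR.init, ucoef, Finset.sum_eq_single j0]
  · simp [hj]
  · intro b _ hb
    simp [hb]
  · simp

lemma integral_ucoef (hR : IsCyclicUrn μ m j0 R) (hj : (j0 : ℕ) = 0) (k n : ℕ) :
    ∫ ω, ucoef m k (R n ω) ∂μ = urnProd (cw m ^ k) n := by
  have := hR.isProb
  induction n with
  | zero => simp [ucoef_init hR hj]
  | succ n ih =>
    rw [urn_integral_succ hR n (continuous_ucoef m k), urnProd_succ, ← ih, mul_comm,
      ← integral_const_mul]
    refine integral_congr_ae ?_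
    filter_upwards [urn_sum hR n] with ω hω
    simp only [ucoef_add_drawVec, smul_add, Finset.sum_add_distrib, ← Finset.sum_smul,
      ← Finset.sum_div, hω, sum_smul_draw]
    rw [div_self (by positivity), one_smul]
    push_cast
    ring

lemma ucoef_expVec (hR : IsCyclicUrn μ m j0 R) (hj : (j0 : ℕ) = 0) (k n : ℕ) :
    ucoef m k (expVec μ (R n)) = urnProd (cw m ^ k) n := by
  rw [← integral_ucoef hR hj]
  simp only [ucoef, expVec]
  rw [integral_finsetSum]
  · refine Finset.sum_congr rfl fun t _ => ?_
    rw [integral_const_mul, integral_complex_ofReal]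
  · intro t _
    exact urn_integrable hR n (G := fun w => cw m ^ (k * (t : ℕ)) * (w t : ℂ)) (by fun_prop)

lemma integral_norm_ucoef_sub_sq_succ (hR : IsCyclicUrn μ m j0 R) (k : ℕ) {i n : ℕ} (hi : i ≤ n)
    {f : (Fin m → ℝ) → ℂ} (hf : Continuous f) :
    ∫ ω, ‖ucoef m k (R (n + 1) ω) - f (R i ω)‖ ^ 2 ∂μ ≤
      ∫ ω, ‖(1 + cw m ^ k / ((n : ℂ) + 1)) * ucoef m k (R n ω) - f (R i ω)‖ ^ 2 ∂μ + 1 := by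
  have := hR.isProb
  have hu := continuous_ucoef m k
  rw [urn_integral_succ_pair hR hi (G := fun p => ‖ucoef m k p.2 - f p.1‖ ^ 2) (by fun_prop)]
  have hint : Integrable (fun ω =>
      ‖(1 + cw m ^ k / ((n : ℂ) + 1)) * ucoef m k (R n ω) - f (R i ω)‖ ^ 2) μ :=
    urn_integrable_pair hR i n
      (G := fun p => ‖(1 + cw m ^ k / ((n : ℂ) + 1)) * ucoef m k p.2 - f p.1‖ ^ 2) (by fun_prop)
  have hone : (1 : ℝ) = ∫ _, (1 : ℝ) ∂μ := by simp
  rw [hone, ← integral_add hint (integrable_const _), ← hone]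
  refine integral_mono_ae ?_ (hint.add (integrable_const _)) ?_
  · refine urn_integrable_pair hR i n (G := fun p => ∑ j, (p.2 j / ((n : ℝ) + 1)) •
      ‖ucoef m k (fun t => p.2 t + drawVec m j t) - f p.1‖ ^ 2) ?_
    fun_prop
  · filter_upwards [urn_sum hR n] with ω hω
    have hp : ∑ j, R n ω j / ((n : ℝ) + 1) = 1 := by
      rw [← Finset.sum_div, hω]
      exact div_self (by positivity)
    have h := sum_mul_norm_add_sq (fun j => R n ω j / ((n : ℝ) + 1)) hp
      (fun j => cw m ^ k * cw m ^ (k * (j : ℕ))) (ucoef m k (R n ω) - f (R i ω))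
    have hnorm : ∀ j : Fin m, ‖cw m ^ k * cw m ^ (k * (j : ℕ))‖ = 1 := fun j => by
      rw [norm_mul, norm_cw_pow, norm_cw_pow, one_mul]
    simp only [hnorm, one_pow, mul_one, hp, sum_smul_draw] at h
    have h2 : ∀ j : Fin m, ucoef m k (fun t => R n ω t + drawVec m j t) - f (R i ω) =
        ucoef m k (R n ω) - f (R i ω) + cw m ^ k * cw m ^ (k * (j : ℕ)) := fun j => by
      rw [ucoef_add_drawVec]; ring
    have h3 : ucoef m k (R n ω) - f (R i ω) + cw m ^ k / ((n + 1 : ℝ) : ℂ) * ucoef m k (R n ω) =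
        (1 + cw m ^ k / ((n : ℂ) + 1)) * ucoef m k (R n ω) - f (R i ω) := by
      push_cast; ring
    rw [h3] at h
    simp only [smul_eq_mul, h2, h]
    have := sq_nonneg ‖cw m ^ k / ((n + 1 : ℝ) : ℂ) * ucoef m k (R n ω)‖
    linarith

lemma exists_second_moment_le (hR : IsCyclicUrn μ m j0 R) (k : ℕ) (α : ℂ) {p : ℝ} (hp1 : 1 ≤ p)
    (hp : 2 * (cw m ^ k).re < p) :
    ∃ K : ℝ, 0 ≤ K ∧ ∀ n : ℕ,
      ∫ ω, ‖ucoef m k (R n ω) - α * urnProd (cw m ^ k) n‖ ^ 2 ∂μ ≤ K * ((n : ℝ) + 1) ^ p := by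
  refine le_rpow_of_recursion hp1 hp (fun n => integral_nonneg fun ω => by positivity)
    (fun n => ?_) (fun n => ?_)
  · rw [← norm_one_add_div_sq (norm_cw_pow m k), ← integral_const_mul]
    refine (integral_norm_ucoef_sub_sq_succ hR k (le_refl n)
      (f := fun _ => α * urnProd (cw m ^ k) (n + 1)) continuous_const).trans (le_of_eq ?_)
    congr 2
    ext ω
    rw [← mul_pow, ← norm_mul, urnProd_succ]
    congr 2
    ring
  · rw [← norm_one_add_div_sq (norm_cw_pow m k)]
    positivity

end Urn

lemma Lp_two_norm_sq {Ω : Type*} [MeasurableSpace Ω] {μ : Measure Ω} (f : Lp ℂ 2 μ) :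
    ‖f‖ ^ 2 = ∫ ω, ‖f ω‖ ^ 2 ∂μ := by
  have h : (inner ℂ f f : ℂ) = ((∫ ω, ‖f ω‖ ^ 2 ∂μ : ℝ) : ℂ) := by
    rw [L2.inner_def, ← integral_complex_ofReal]
    refine integral_congr_ae (Eventually.of_forall fun ω => ?_)
    simp only [inner_self_eq_norm_sq_to_K]
    push_cast
    rfl
  rw [inner_self_eq_norm_sq_to_K] at h
  refine Complex.ofReal_injective (h ▸ ?_)
  push_cast
  rfl

lemma integral_norm_le_sqrt {Ω : Type*} [MeasurableSpace Ω] {μ : Measure Ω}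
    [IsProbabilityMeasure μ] {X : Ω → ℂ} (hX : MemLp X 2 μ) {c : ℝ}
    (h : ∫ ω, ‖X ω‖ ^ 2 ∂μ ≤ c) : ∫ ω, ‖X ω‖ ∂μ ≤ √c := by
  have hv := variance_nonneg (fun ω => ‖X ω‖) μ
  rw [variance_eq_sub hX.norm] at hv
  exact Real.le_sqrt_of_sq_le ((sub_nonneg.1 hv).trans h)

lemma urnProd_norm_bounds {z : ℂ} (hz : 0 < z.re) (hz1 : ‖z‖ ≤ 1) :
    ∃ c C : ℝ, 0 < c ∧ 0 < C ∧ ∀ n : ℕ, 1 ≤ n →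
      c * (n : ℝ) ^ z.re ≤ ‖urnProd z n‖ ∧ ‖urnProd z n‖ ≤ C * (n : ℝ) ^ z.re := by
  obtain ⟨b, hb, C, hC, h⟩ := urnProd_asymp hz hz1
  have hn : ∀ n : ℕ, 1 ≤ n → ‖(n : ℂ) ^ z‖ = (n : ℝ) ^ z.re := fun n hn =>
    norm_natCast_cpow_of_pos hn z
  have hlim : Tendsto (fun n : ℕ => urnProd z n / (n : ℂ) ^ z) atTop (𝓝 b) := by
    rw [tendsto_iff_norm_sub_tendsto_zero]
    refine squeeze_zero' (Eventually.of_forall fun n => norm_nonneg _) ?_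
      (tendsto_const_div_atTop_nhds_zero_nat C)
    filter_upwards [eventually_ge_atTop 1] with n hn using h n hn
  have hlim1 := hlim.norm
  have hlim2 := hlim1.inv₀ (norm_ne_zero_iff.2 hb)
  obtain ⟨B, hB⟩ := hlim1.bddAbove_range
  obtain ⟨B', hB'⟩ := hlim2.bddAbove_range
  have hpos : ∀ n : ℕ, 1 ≤ n → 0 < ‖urnProd z n / (n : ℂ) ^ z‖ := fun n hn1 => by
    rw [norm_div, hn n hn1]
    have := norm_pos_iff.2 (urnProd_ne_zero hz n)
    have : (0 : ℝ) < n := by exact_mod_cast hn1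
    positivity
  have hB0 : 0 < B := (hpos 1 le_rfl).trans_le (hB ⟨1, rfl⟩)
  have hB0' : 0 < B' := (inv_pos.2 (hpos 1 le_rfl)).trans_le (hB' ⟨1, rfl⟩)
  refine ⟨B'⁻¹, B, by positivity, hB0, fun n hn1 => ?_⟩
  have h1 : ‖urnProd z n / (n : ℂ) ^ z‖ ≤ B := hB ⟨n, rfl⟩
  have h2 : ‖urnProd z n / (n : ℂ) ^ z‖⁻¹ ≤ B' := hB' ⟨n, rfl⟩
  have hn0 : (0 : ℝ) < n := by exact_mod_cast hn1
  have h3 := inv_le_of_inv_le₀ (hpos n hn1) h2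
  rw [norm_div, hn n hn1] at h1 h3
  have hr : 0 < (n : ℝ) ^ z.re := by positivity
  exact ⟨(le_div_iff₀ hr).1 h3, (div_le_iff₀ hr).1 h1⟩

lemma rpow_neg_le_telescope {s : ℝ} (hs : 0 < s) {n : ℕ} (hn : 1 ≤ n) :
    s * ((n : ℝ) + 1) ^ (-(s + 1)) ≤ (n : ℝ) ^ (-s) - ((n : ℝ) + 1) ^ (-s) := by
  have hn0 : (0 : ℝ) < n := by exact_mod_cast hn
  set y : ℝ := (n : ℝ) + 1 with hy
  have hy0 : 0 < y := by positivity
  have h1 : (n : ℝ) ^ (-s) = y ^ (-s) * ((n : ℝ) / y) ^ (-s) := by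
    rw [← Real.mul_rpow hy0.le (by positivity), mul_div_cancel₀ _ hy0.ne']
  have h2 : 1 + s / y ≤ ((n : ℝ) / y) ^ (-s) := by
    rw [Real.rpow_def_of_pos (by positivity)]
    have hl := Real.log_le_sub_one_of_pos (show 0 < (n : ℝ) / y by positivity)
    have he := Real.add_one_le_exp (Real.log ((n : ℝ) / y) * -s)
    have : (n : ℝ) / y - 1 = -(1 / y) := by rw [hy]; field_simp; ring
    rw [this] at hl
    have h3 : s * Real.log ((n : ℝ) / y) ≤ s * -(1 / y) := by gcongr
    have h4 : s / y = s * (1 / y) := by ring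
    linarith
  have h5 : y ^ (-(s + 1)) = y ^ (-s) / y := by
    rw [show -(s + 1) = -s - 1 by ring, Real.rpow_sub_one hy0.ne']
  rw [h1, h5]
  have h6 : y ^ (-s) * (1 + s / y) ≤ y ^ (-s) * ((n : ℝ) / y) ^ (-s) := by gcongr
  have h7 : s * (y ^ (-s) / y) = y ^ (-s) * (1 + s / y) - y ^ (-s) := by ring
  linarith

section Urn

variable {Ω : Type*} [mΩ : MeasurableSpace Ω] {μ : Measure Ω} {m : ℕ} {j0 : Fin m}
  {R : ℕ → Ω → Fin m → ℝ}

lemma urn_memLp (hR : IsCyclicUrn μ m j0 R) (n : ℕ) {G : (Fin m → ℝ) → ℂ} (hG : Continuous G) :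
    MemLp (fun ω => G (R n ω)) 2 μ := by
  rw [memLp_two_iff_integrable_sq_norm (urn_integrable hR n hG).aestronglyMeasurable]
  exact urn_integrable hR n (G := fun w => ‖G w‖ ^ 2) (by fun_prop)

lemma integral_normalized_sub_sq_le (hR : IsCyclicUrn μ m j0 R) (k : ℕ)
    (hk : 1 / 2 < (cw m ^ k).re) :
    ∃ K : ℝ, 0 ≤ K ∧ ∀ n : ℕ, 1 ≤ n → ∀ l : ℕ,
      ∫ ω, ‖ucoef m k (R (n + l) ω) / urnProd (cw m ^ k) (n + l) -
        ucoef m k (R n ω) / urnProd (cw m ^ k) n‖ ^ 2 ∂μ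
        ≤ K * ((n : ℝ) ^ (1 - 2 * (cw m ^ k).re) - ((n + l : ℕ) : ℝ) ^ (1 - 2 * (cw m ^ k).re)) := by
  set z := cw m ^ k with hz
  have hz0 : 0 < z.re := by linarith
  obtain ⟨c, C, hc, -, hcC⟩ := urnProd_norm_bounds hz0 (norm_cw_pow m k).le
  set s : ℝ := 2 * z.re - 1 with hs
  have hs0 : 0 < s := by linarith
  have he : 1 - 2 * z.re = -s := by ring
  refine ⟨(c ^ 2 * s)⁻¹, by positivity, fun n hn l => ?_⟩
  rw [he]
  induction l with
  | zero => simp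
  | succ l ih =>
    set N := n + l with hN
    have hN1 : 1 ≤ N := by omega
    have hPn := urnProd_ne_zero hz0 n
    have hPN := urnProd_ne_zero hz0 N
    have hPN1 := urnProd_ne_zero hz0 (N + 1)
    have hstep := integral_norm_ucoef_sub_sq_succ hR k (i := n) (n := N) (by omega)
      (f := fun w => urnProd z (N + 1) / urnProd z n * ucoef m k w)
      (continuous_const.mul (continuous_ucoef m k))
    have h1 : ∀ ω, ‖ucoef m k (R (N + 1) ω) -
        urnProd z (N + 1) / urnProd z n * ucoef m k (R n ω)‖ ^ 2 = ‖urnProd z (N + 1)‖ ^ 2 *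
        ‖ucoef m k (R (N + 1) ω) / urnProd z (N + 1) - ucoef m k (R n ω) / urnProd z n‖ ^ 2 := by
      intro ω
      rw [← mul_pow, ← norm_mul]
      congr 2
      field_simp
    have h2 : ∀ ω, ‖(1 + cw m ^ k / ((N : ℂ) + 1)) * ucoef m k (R N ω) -
        urnProd z (N + 1) / urnProd z n * ucoef m k (R n ω)‖ ^ 2 = ‖urnProd z (N + 1)‖ ^ 2 *
        ‖ucoef m k (R N ω) / urnProd z N - ucoef m k (R n ω) / urnProd z n‖ ^ 2 := by
      intro ω
      rw [← mul_pow, ← norm_mul, urnProd_succ, ← hz]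
      congr 2
      field_simp
    simp only [h1, h2, integral_const_mul] at hstep
    have hP : 0 < ‖urnProd z (N + 1)‖ ^ 2 := by positivity
    have h3 : ∫ ω, ‖ucoef m k (R (N + 1) ω) / urnProd z (N + 1) -
        ucoef m k (R n ω) / urnProd z n‖ ^ 2 ∂μ ≤
        ∫ ω, ‖ucoef m k (R N ω) / urnProd z N - ucoef m k (R n ω) / urnProd z n‖ ^ 2 ∂μ +
          1 / ‖urnProd z (N + 1)‖ ^ 2 := by
      refine le_of_mul_le_mul_left (hstep.trans (le_of_eq ?_)) hP
      rw [mul_add, mul_one_div_cancel hP.ne']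
    have h4 : 1 / ‖urnProd z (N + 1)‖ ^ 2 ≤
        (c ^ 2 * s)⁻¹ * ((N : ℝ) ^ (-s) - ((N : ℝ) + 1) ^ (-s)) := by
      have hb := (hcC (N + 1) (by omega)).1
      push_cast at hb
      have hN0 : (0 : ℝ) < (N : ℝ) + 1 := by positivity
      have hpw : ((N : ℝ) + 1) ^ (-(s + 1)) = 1 / (((N : ℝ) + 1) ^ z.re) ^ 2 := by
        rw [show -(s + 1) = -(z.re * 2) by rw [hs]; ring, Real.rpow_neg hN0.le,
          Real.rpow_mul hN0.le, Real.rpow_two, one_div]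
      calc 1 / ‖urnProd z (N + 1)‖ ^ 2 ≤ 1 / (c * ((N : ℝ) + 1) ^ z.re) ^ 2 := by gcongr
        _ = (c ^ 2 * s)⁻¹ * (s * ((N : ℝ) + 1) ^ (-(s + 1))) := by
            rw [hpw]; field_simp
        _ ≤ _ := by
            gcongr
            exact rpow_neg_le_telescope hs0 hN1
    rw [← add_assoc, ← hN]
    push_cast
    refine (h3.trans (add_le_add ih h4)).trans (le_of_eq ?_)
    ring

lemma exists_normalized_limit (hR : IsCyclicUrn μ m j0 R) (k : ℕ)
    (hk : 1 / 2 < (cw m ^ k).re) :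
    ∃ Ξ : Ω → ℂ, StronglyMeasurable Ξ ∧ MemLp Ξ 2 μ ∧ ∃ K : ℝ, 0 ≤ K ∧ ∀ n : ℕ, 1 ≤ n →
      ∫ ω, ‖ucoef m k (R n ω) / urnProd (cw m ^ k) n - Ξ ω‖ ^ 2 ∂μ
        ≤ K * (n : ℝ) ^ (1 - 2 * (cw m ^ k).re) := by
  obtain ⟨K, hK, h⟩ := integral_normalized_sub_sq_le hR k hk
  set z := cw m ^ k with hz
  have hM : ∀ n, MemLp (fun ω => ucoef m k (R n ω) / urnProd z n) 2 μ := fun n =>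
    urn_memLp hR n ((continuous_ucoef m k).div_const _)
  set f : ℕ → Lp ℂ 2 μ := fun n => (hM n).toLp _ with hf
  have hdist : ∀ n l, ‖f (n + l) - f n‖ ^ 2 = ∫ ω, ‖ucoef m k (R (n + l) ω) / urnProd z (n + l) -
      ucoef m k (R n ω) / urnProd z n‖ ^ 2 ∂μ := by
    intro n l
    rw [Lp_two_norm_sq]
    refine integral_congr_ae ?_
    filter_upwards [Lp.coeFn_sub (f (n + l)) (f n), (hM (n + l)).coeFn_toLp,
      (hM n).coeFn_toLp] with ω h1 h2 h3
    rw [h1, Pi.sub_apply, h2, h3]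
  have hbound : ∀ n, 1 ≤ n → ∀ l, ‖f (n + l) - f n‖ ^ 2 ≤ K * (n : ℝ) ^ (1 - 2 * z.re) := by
    intro n hn l
    rw [hdist]
    refine (h n hn l).trans ?_
    have : (0 : ℝ) ≤ ((n + l : ℕ) : ℝ) ^ (1 - 2 * z.re) := by positivity
    gcongr
    linarith
  have hrate : Tendsto (fun n : ℕ => √(K * (n : ℝ) ^ (1 - 2 * z.re))) atTop (𝓝 0) := by
    have h1 : Tendsto (fun n : ℕ => (n : ℝ) ^ (-(2 * z.re - 1))) atTop (𝓝 0) :=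
      (tendsto_rpow_neg_atTop (by linarith)).comp tendsto_natCast_atTop_atTop
    have h2 := (h1.const_mul K).sqrt
    simpa [show -(2 * z.re - 1) = 1 - 2 * z.re by ring] using h2
  have hcauchy : CauchySeq f := by
    rw [Metric.cauchySeq_iff']
    intro ε hε
    obtain ⟨N, hN1, hN2⟩ := ((hrate.eventually_lt_const hε).and (eventually_ge_atTop 1)).exists
    refine ⟨N, fun n hn => ?_⟩
    obtain ⟨l, rfl⟩ := Nat.exists_eq_add_of_le hn
    rw [dist_eq_norm]
    exact (Real.le_sqrt_of_sq_le (hbound N hN2 l)).trans_lt hN1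
  obtain ⟨F, hF⟩ := cauchySeq_tendsto_of_complete hcauchy
  refine ⟨F, Lp.stronglyMeasurable F, Lp.memLp F, K, hK, fun n hn => ?_⟩
  have hlim : Tendsto (fun l => ‖f (n + l) - f n‖ ^ 2) atTop (𝓝 (‖F - f n‖ ^ 2)) := by
    have : Tendsto (fun l => f (n + l)) atTop (𝓝 F) := by
      simpa only [add_comm] using (tendsto_add_atTop_iff_nat n).2 hF
    exact ((this.sub_const _).norm).pow 2
  have hle := le_of_tendsto' hlim (hbound n hn)
  rw [norm_sub_rev, Lp_two_norm_sq] at hle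
  refine le_trans (le_of_eq (integral_congr_ae ?_)) hle
  filter_upwards [Lp.coeFn_sub (f n) F, (hM n).coeFn_toLp] with ω h1 h3
  rw [h1, Pi.sub_apply, h3]

/-- Supercritical modes converge after normalisation, up to an error of order `√n`. -/
lemma exists_limit_of_re_gt (hR : IsCyclicUrn μ m j0 R) (k : ℕ) (hk : 1 / 2 < (cw m ^ k).re) :
    ∃ Ξ : Ω → ℂ, StronglyMeasurable Ξ ∧ Integrable Ξ μ ∧ ∃ K : ℝ, ∀ n : ℕ, 1 ≤ n →
      ∫ ω, ‖ucoef m k (R n ω) - urnProd (cw m ^ k) n - (n : ℂ) ^ (cw m ^ k) * Ξ ω‖ ∂μ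
        ≤ K * √n := by
  have := hR.isProb
  obtain ⟨Ξ, hΞm, hΞ, K, hK, h⟩ := exists_normalized_limit hR k hk
  set z := cw m ^ k with hz
  have hz0 : 0 < z.re := by linarith
  have hz1 : ‖z‖ ≤ 1 := (norm_cw_pow m k).le
  have hzre : z.re ≤ 1 := (re_le_norm z).trans hz1
  obtain ⟨c, C, hc, hC, hcC⟩ := urnProd_norm_bounds hz0 hz1
  obtain ⟨b, hb, C', hC', hbb⟩ := urnProd_asymp hz0 hz1
  have hΞ1 : MemLp (fun ω => Ξ ω - 1) 2 μ := hΞ.sub (memLp_const 1)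
  have hΞ1i : Integrable (fun ω => Ξ ω - 1) μ := hΞ1.integrable (by norm_num)
  refine ⟨fun ω => b * (Ξ ω - 1), (hΞm.sub stronglyMeasurable_const).const_mul b,
    hΞ1i.const_mul b, C * √K + C' * ∫ ω, ‖Ξ ω - 1‖ ∂μ, fun n hn => ?_⟩
  have hn0 : (0 : ℝ) < n := by exact_mod_cast hn
  have hPn := urnProd_ne_zero hz0 n
  have hM : MemLp (fun ω => ucoef m k (R n ω) / urnProd z n - Ξ ω) 2 μ :=
    (urn_memLp hR n ((continuous_ucoef m k).div_const _)).sub hΞ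
  have hMi := (hM.integrable (by norm_num)).norm
  have hMle := integral_norm_le_sqrt hM (h n hn)
  have hpt : ∀ ω, ‖ucoef m k (R n ω) - urnProd z n - (n : ℂ) ^ z * (b * (Ξ ω - 1))‖ ≤
      ‖urnProd z n‖ * ‖ucoef m k (R n ω) / urnProd z n - Ξ ω‖ +
        ‖urnProd z n - (n : ℂ) ^ z * b‖ * ‖Ξ ω - 1‖ := by
    intro ω
    rw [← norm_mul, ← norm_mul]
    refine le_trans (le_of_eq ?_) (norm_add_le _ _)
    congr 1
    field_simp
    ring
  have hnz : (n : ℂ) ^ z ≠ 0 := by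
    rw [← norm_pos_iff, norm_natCast_cpow_of_pos hn]
    positivity
  have hsq1 : 1 ≤ √(n : ℝ) := Real.one_le_sqrt.2 (by exact_mod_cast hn)
  have hdiff : ‖urnProd z n - (n : ℂ) ^ z * b‖ ≤ C' * √n := by
    have h1 : urnProd z n - (n : ℂ) ^ z * b = (n : ℂ) ^ z * (urnProd z n / (n : ℂ) ^ z - b) := by
      field_simp
    rw [h1, norm_mul, norm_natCast_cpow_of_pos hn]
    calc (n : ℝ) ^ z.re * ‖urnProd z n / (n : ℂ) ^ z - b‖ ≤ n * (C' / n) := by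
          gcongr
          · conv_rhs => rw [← Real.rpow_one (n : ℝ)]
            exact Real.rpow_le_rpow_of_exponent_le (by exact_mod_cast hn) hzre
          · exact hbb n hn
      _ = C' * 1 := by field_simp
      _ ≤ C' * √n := by gcongr
  have hsqrt : (n : ℝ) ^ z.re * √(K * (n : ℝ) ^ (1 - 2 * z.re)) = √K * √n := by
    rw [Real.sqrt_mul hK, Real.sqrt_eq_rpow ((n : ℝ) ^ (1 - 2 * z.re)), ← Real.rpow_mul hn0.le,
      Real.sqrt_eq_rpow (n : ℝ), mul_left_comm, ← Real.rpow_add hn0]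
    congr 2
    ring
  calc _ ≤ ∫ ω, (‖urnProd z n‖ * ‖ucoef m k (R n ω) / urnProd z n - Ξ ω‖ +
        ‖urnProd z n - (n : ℂ) ^ z * b‖ * ‖Ξ ω - 1‖) ∂μ := by
        refine integral_mono_of_nonneg ?_
          ((hMi.const_mul _).add (hΞ1i.norm.const_mul _)) (Eventually.of_forall hpt)
        exact Eventually.of_forall fun ω => norm_nonneg _
    _ = ‖urnProd z n‖ * ∫ ω, ‖ucoef m k (R n ω) / urnProd z n - Ξ ω‖ ∂μ +
        ‖urnProd z n - (n : ℂ) ^ z * b‖ * ∫ ω, ‖Ξ ω - 1‖ ∂μ := by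
        rw [integral_add (hMi.const_mul _) (hΞ1i.norm.const_mul _), integral_const_mul,
          integral_const_mul]
    _ ≤ C * (n : ℝ) ^ z.re * √(K * (n : ℝ) ^ (1 - 2 * z.re)) +
        C' * √n * ∫ ω, ‖Ξ ω - 1‖ ∂μ := by
        gcongr
        exact (hcC n hn).2
    _ = _ := by
        rw [mul_assoc, hsqrt]
        ring

/-- Subcritical modes are of order `√n`. -/
lemma integral_norm_le_of_re_lt (hR : IsCyclicUrn μ m j0 R) (k : ℕ) (hk : (cw m ^ k).re < 1 / 2)
    (α : ℂ) : ∃ K : ℝ, 0 ≤ K ∧ ∀ n : ℕ,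
      ∫ ω, ‖ucoef m k (R n ω) - α * urnProd (cw m ^ k) n‖ ∂μ ≤ K * √((n : ℝ) + 1) := by
  have := hR.isProb
  obtain ⟨K, hK, h⟩ := exists_second_moment_le hR k α le_rfl (by linarith)
  refine ⟨√K, Real.sqrt_nonneg _, fun n => ?_⟩
  rw [← Real.sqrt_mul hK]
  refine integral_norm_le_sqrt (urn_memLp hR n
    (G := fun w => ucoef m k w - α * urnProd (cw m ^ k) n)
    ((continuous_ucoef m k).sub continuous_const)) ?_
  simpa using h n

end Urn

lemma sum_smul_cexp_sub_le {ι : Type*} [Fintype ι] {p : ι → ℝ} (hp0 : ∀ j, 0 ≤ p j)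
    (hp : ∑ j, p j = 1) {x : ι → ℝ} (hx : ∑ j, p j * x j = 0) {t v : ℝ} (ht : t ≤ 1)
    (hxt : ∀ j, |x j| ≤ t) (hv0 : 0 ≤ v) (hv1 : v ≤ 2) :
    ‖∑ j, p j • cexp (I * x j) - cexp (-(v / 2 : ℝ))‖ ≤
      t ^ 3 / 4 + |∑ j, p j * x j ^ 2 - v| / 2 + v ^ 2 / 4 := by
  have hr : ∀ j, ‖cexp (I * x j) - (1 + I * x j - (x j : ℂ) ^ 2 / 2)‖ ≤ t ^ 3 / 4 := by
    intro j
    have hn : ‖I * (x j : ℂ)‖ = |x j| := by simp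
    have h := Complex.exp_bound (x := I * x j) (by rw [hn]; exact (hxt j).trans ht)
      (n := 3) (by norm_num)
    rw [hn] at h
    have hs : ∑ i ∈ Finset.range 3, (I * (x j : ℂ)) ^ i / (i.factorial : ℂ) =
        1 + I * x j - (x j : ℂ) ^ 2 / 2 := by
      simp [Finset.sum_range_succ, mul_pow]
      ring
    rw [hs] at h
    refine h.trans ?_
    have h3 : |x j| ^ 3 ≤ t ^ 3 := by
      gcongr
      exact hxt j
    have h4 : 0 ≤ |x j| ^ 3 := by positivity
    norm_num [Nat.factorial] at h ⊢
    linarith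
  have he : ‖cexp (-(v / 2 : ℝ)) - 1 - (-(v / 2 : ℝ))‖ ≤ v ^ 2 / 4 := by
    have hn : ‖(-(v / 2 : ℝ) : ℂ)‖ = v / 2 := by
      rw [norm_neg, norm_real, Real.norm_of_nonneg (by positivity)]
    refine (Complex.norm_exp_sub_one_sub_id_le (by rw [hn]; linarith)).trans ?_
    rw [hn]
    linarith
  have hdec : ∑ j, p j • cexp (I * x j) - cexp (-(v / 2 : ℝ)) =
      ∑ j, p j • (cexp (I * x j) - (1 + I * x j - (x j : ℂ) ^ 2 / 2)) -
        ((∑ j, p j * x j ^ 2 - v : ℝ) : ℂ) / 2 - (cexp (-(v / 2 : ℝ)) - 1 - (-(v / 2 : ℝ))) := by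
    have h1 : ∑ j, p j • (1 + I * (x j : ℂ) - (x j : ℂ) ^ 2 / 2) =
        1 - ((∑ j, p j * x j ^ 2 : ℝ) : ℂ) / 2 := by
      have : ∀ j, p j • (1 + I * (x j : ℂ) - (x j : ℂ) ^ 2 / 2) =
          (p j : ℂ) + I * ((p j * x j : ℝ) : ℂ) - ((p j * x j ^ 2 : ℝ) : ℂ) / 2 := by
        intro j
        rw [real_smul]
        push_cast
        ring
      simp only [this, Finset.sum_sub_distrib, Finset.sum_add_distrib, ← Finset.mul_sum,
        ← Finset.sum_div, ← ofReal_sum, hp, hx]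
      simp
    simp only [smul_sub (_ : ℝ) (cexp _), Finset.sum_sub_distrib, h1]
    push_cast
    ring
  rw [hdec]
  refine (norm_sub_le _ _).trans (add_le_add ((norm_sub_le _ _).trans (add_le_add ?_ ?_)) he)
  · refine (norm_sum_le _ _).trans ?_
    calc ∑ j, ‖p j • (cexp (I * x j) - (1 + I * x j - (x j : ℂ) ^ 2 / 2))‖
        ≤ ∑ j, p j * (t ^ 3 / 4) := by
          refine Finset.sum_le_sum fun j _ => ?_
          rw [norm_smul, Real.norm_of_nonneg (hp0 j)]
          exact mul_le_mul_of_nonneg_left (hr j) (hp0 j)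
      _ = t ^ 3 / 4 := by rw [← Finset.sum_mul, hp, one_mul]
  · rw [norm_div, norm_real, Real.norm_eq_abs]
    simp

lemma re_sq_eq (w : ℂ) : w.re ^ 2 = ‖w‖ ^ 2 / 2 + (w ^ 2).re / 2 := by
  rw [Complex.sq_norm, normSq_apply, sq w, mul_re]
  ring

/-- One step of the characteristic-function recursion, for increments of modulus one. -/
lemma charFun_step_le {ι : Type*} [Fintype ι] {p : ι → ℝ} (hp0 : ∀ j, 0 ≤ p j)
    (hp : ∑ j, p j = 1) {c : ι → ℂ} (hc : ∀ j, ‖c j‖ = 1) {θ : ℂ} (hθ : ‖θ‖ ≤ 1 / 2) :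
    ‖∑ j, p j • cexp (I * ((θ * (c j - ∑ l, p l • c l)).re : ℝ)) - cexp (-(‖θ‖ ^ 2 / 4 : ℝ))‖ ≤
      4 * ‖θ‖ ^ 3 + ‖θ‖ ^ 2 * (‖∑ j, p j • c j‖ ^ 2 + ‖∑ j, p j • c j ^ 2‖) := by
  set a := ∑ l, p l • c l with ha
  set x : ι → ℝ := fun j => (θ * (c j - a)).re with hx
  have hθ0 := norm_nonneg θ
  have ha1 : ‖a‖ ≤ 1 := by
    refine (norm_sum_le _ _).trans (le_of_eq ?_)
    simp only [norm_smul, hc, mul_one, Real.norm_of_nonneg (hp0 _), hp]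
  have hmean : ∑ j, p j • (c j - a) = 0 := by
    simp only [smul_sub, Finset.sum_sub_distrib, ← Finset.sum_smul, hp, one_smul, ← ha, sub_self]
  have hx0 : ∑ j, p j * x j = 0 := by
    have : ∑ j, p j * x j = (θ * ∑ j, p j • (c j - a)).re := by
      rw [Finset.mul_sum, re_sum]
      refine Finset.sum_congr rfl fun j _ => ?_
      rw [mul_smul_comm, smul_re, smul_eq_mul]
    rw [this, hmean, mul_zero, zero_re]
  have hxt : ∀ j, |x j| ≤ 2 * ‖θ‖ := by
    intro j
    refine (abs_re_le_norm _).trans ?_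
    rw [norm_mul, mul_comm 2]
    gcongr
    refine (norm_sub_le _ _).trans ?_
    rw [hc]
    linarith
  have hvar : ∑ j, p j * ‖c j - a‖ ^ 2 = 1 - ‖a‖ ^ 2 := by
    have h := sum_mul_norm_add_sq p hp c (-a)
    simp only [hc, one_pow, mul_one, hp, ← ha, neg_add_cancel, norm_zero] at h
    simp only [show ∀ j, c j - a = -a + c j from fun j => by ring, h]
    ring
  have hpv : ∑ j, p j • (c j - a) ^ 2 = ∑ j, p j • c j ^ 2 - a ^ 2 := by
    have : ∀ j, p j • (c j - a) ^ 2 = p j • c j ^ 2 - 2 * a * (p j • c j) + p j • a ^ 2 := by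
      intro j
      simp only [real_smul]
      ring
    simp only [this, Finset.sum_add_distrib, Finset.sum_sub_distrib, ← Finset.mul_sum, ← ha,
      ← Finset.sum_smul, hp, one_smul]
    ring
  have hx2 : ∑ j, p j * x j ^ 2 = ‖θ‖ ^ 2 * (1 - ‖a‖ ^ 2) / 2 +
      (θ ^ 2 * (∑ j, p j • c j ^ 2 - a ^ 2)).re / 2 := by
    rw [← hvar, ← hpv, Finset.mul_sum, Finset.mul_sum, re_sum, Finset.sum_div, Finset.sum_div,
      ← Finset.sum_add_distrib]
    refine Finset.sum_congr rfl fun j _ => ?_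
    simp only [hx]
    rw [re_sq_eq, norm_mul, mul_pow, mul_pow θ, mul_smul_comm, smul_re, smul_eq_mul]
    ring
  have h := sum_smul_cexp_sub_le hp0 hp hx0 (t := 2 * ‖θ‖) (v := ‖θ‖ ^ 2 / 2) (by linarith) hxt
    (by positivity) (by nlinarith)
  have hd : |∑ j, p j * x j ^ 2 - ‖θ‖ ^ 2 / 2| ≤
      ‖θ‖ ^ 2 * (‖a‖ ^ 2 + ‖∑ j, p j • c j ^ 2‖) := by
    have h1 : |(θ ^ 2 * (∑ j, p j • c j ^ 2 - a ^ 2)).re| ≤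
        ‖θ‖ ^ 2 * (‖∑ j, p j • c j ^ 2‖ + ‖a‖ ^ 2) := by
      refine (abs_re_le_norm _).trans ?_
      rw [norm_mul, norm_pow, ← norm_pow a]
      gcongr
      exact norm_sub_le _ _
    have h0 : 0 ≤ ‖θ‖ ^ 2 * ‖a‖ ^ 2 := by positivity
    have h2 : 0 ≤ ‖θ‖ ^ 2 * ‖∑ j, p j • c j ^ 2‖ := by positivity
    rw [hx2, abs_le]
    rw [abs_le] at h1
    constructor <;> nlinarith [h1.1, h1.2]
  have hv4 : (‖θ‖ ^ 2 / 2 / 2 : ℝ) = ‖θ‖ ^ 2 / 4 := by ring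
  rw [hv4] at h
  refine h.trans ?_
  have h4 : (‖θ‖ ^ 2 / 2) ^ 2 / 4 ≤ ‖θ‖ ^ 3 := by
    have : ‖θ‖ ^ 3 * ‖θ‖ ≤ ‖θ‖ ^ 3 * 1 := by gcongr; linarith
    nlinarith [pow_nonneg hθ0 3]
  have h5 : 0 ≤ ‖θ‖ ^ 2 * (‖a‖ ^ 2 + ‖∑ j, p j • c j ^ 2‖) := by positivity
  have h6 : (2 * ‖θ‖) ^ 3 / 4 = 2 * ‖θ‖ ^ 3 := by ring
  have h7 : 0 ≤ ‖θ‖ ^ 3 := by positivity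
  linarith

lemma sum_inv_norm_urnProd_sq_div_log {z b : ℂ} (hz : z.re = 1 / 2) (hb : b ≠ 0)
    (hlim : Tendsto (fun n : ℕ => urnProd z n / (n : ℂ) ^ z) atTop (𝓝 b)) :
    Tendsto (fun N : ℕ => (∑ j ∈ Finset.range N, (‖urnProd z (j + 1)‖ ^ 2)⁻¹) / Real.log N) atTop
      (𝓝 (‖b‖ ^ 2)⁻¹) := by
  have hb2 : ‖b‖ ^ 2 ≠ 0 := by positivity
  set g : ℕ → ℝ := fun j => 1 / ((j : ℝ) + 1) with hg
  set f : ℕ → ℝ := fun j => (‖urnProd z (j + 1)‖ ^ 2)⁻¹ - (‖b‖ ^ 2)⁻¹ * g j with hf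
  have hg0 : ∀ j, 0 < g j := fun j => by simp only [hg]; positivity
  have hsq : ∀ n : ℕ, ‖(n : ℂ) ^ z‖ ^ 2 = n := by
    intro n
    rcases Nat.eq_zero_or_pos n with rfl | hn
    · have : z ≠ 0 := fun h => by norm_num [h] at hz
      simp [this]
    · rw [norm_natCast_cpow_of_pos hn, hz, ← Real.rpow_natCast, ← Real.rpow_mul (by positivity)]
      norm_num
  have hfg : f =o[atTop] g := by
    rw [Asymptotics.isLittleO_iff_tendsto fun j h => absurd h (hg0 j).ne']
    have h1 : Tendsto (fun n : ℕ => (‖urnProd z n / (n : ℂ) ^ z‖ ^ 2)⁻¹ - (‖b‖ ^ 2)⁻¹) atTop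
        (𝓝 ((‖b‖ ^ 2)⁻¹ - (‖b‖ ^ 2)⁻¹)) := ((hlim.norm.pow 2).inv₀ hb2).sub_const _
    rw [sub_self] at h1
    refine (h1.comp (tendsto_add_atTop_nat 1)).congr fun j => ?_
    simp only [Function.comp, hf, hg]
    rw [norm_div, div_pow, hsq]
    push_cast
    field_simp
  have hharm : ∀ N : ℕ, ∑ j ∈ Finset.range N, g j = (harmonic N : ℝ) := by
    intro N
    simp [harmonic, hg]
  have hlog : Tendsto (fun N : ℕ => Real.log N) atTop atTop :=
    Real.tendsto_log_atTop.comp tendsto_natCast_atTop_atTop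
  have hratio : Tendsto (fun N : ℕ => (harmonic N : ℝ) / Real.log N) atTop (𝓝 1) := by
    have h1 : Tendsto (fun N : ℕ => ((harmonic N : ℝ) - Real.log N) / Real.log N) atTop (𝓝 0) :=
      Real.tendsto_harmonic_sub_log.div_atTop hlog
    have h2 := h1.add_const 1
    rw [zero_add] at h2
    refine h2.congr' ?_
    filter_upwards [hlog.eventually_gt_atTop 0] with N hN
    field_simp
    ring
  have hgtop : Tendsto (fun N => ∑ j ∈ Finset.range N, g j) atTop atTop := by
    simp only [hharm]
    have h2 := Real.tendsto_harmonic_sub_log.add_atTop hlog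
    refine h2.congr fun N => ?_
    ring
  have hsum := hfg.sum_range (fun j => (hg0 j).le) hgtop
  have h3 : Tendsto (fun N : ℕ => (∑ j ∈ Finset.range N, f j) / (∑ j ∈ Finset.range N, g j)) atTop
      (𝓝 0) := hsum.tendsto_div_nhds_zero
  have h4 := (h3.add_const (‖b‖ ^ 2)⁻¹).mul hratio
  rw [zero_add, mul_one] at h4
  refine h4.congr' ?_
  filter_upwards [hgtop.eventually_gt_atTop 0] with N hN
  rw [← hharm]
  simp only [hf, Finset.sum_sub_distrib, ← Finset.mul_sum]
  rw [div_add' _ _ _ hN.ne', div_mul_div_cancel₀ hN.ne']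
  congr 1
  ring

section Critical

variable {Ω : Type*} [mΩ : MeasurableSpace Ω] {μ : Measure Ω} {m : ℕ} {j0 : Fin m}
  {R : ℕ → Ω → Fin m → ℝ}

lemma continuous_charFun_integrand (k : ℕ) (γ P : ℂ) :
    Continuous fun w : Fin m → ℝ => cexp (I * ((γ * (ucoef m k w / P - 1)).re : ℝ)) := by
  have := continuous_ucoef m k
  fun_prop

lemma norm_sum_cexp_draw_sub_le (k n : ℕ) (hz : 0 < (cw m ^ k).re) {w : Fin m → ℝ}
    (hw0 : ∀ i, 0 ≤ w i) (hw : ∑ i, w i = (n : ℝ) + 1) {γ : ℂ}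
    (hγ : ‖γ / urnProd (cw m ^ k) (n + 1)‖ ≤ 1 / 2) :
    ‖(∑ j, (w j / ((n : ℝ) + 1)) • cexp (I * ((γ * (ucoef m k (fun i => w i + drawVec m j i) /
        urnProd (cw m ^ k) (n + 1) - 1)).re : ℝ))) -
      cexp (-(‖γ / urnProd (cw m ^ k) (n + 1)‖ ^ 2 / 4 : ℝ)) *
        cexp (I * ((γ * (ucoef m k w / urnProd (cw m ^ k) n - 1)).re : ℝ))‖ ≤
      4 * ‖γ / urnProd (cw m ^ k) (n + 1)‖ ^ 3 + ‖γ / urnProd (cw m ^ k) (n + 1)‖ ^ 2 *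
        (‖ucoef m k w‖ ^ 2 / ((n : ℝ) + 1) ^ 2 + ‖ucoef m (2 * k) w‖ / ((n : ℝ) + 1)) := by
  set z := cw m ^ k with hzdef
  set θ := γ / urnProd z (n + 1) with hθ
  have hn : (0 : ℝ) < (n : ℝ) + 1 := by positivity
  have hnC : ((n : ℂ) + 1) ≠ 0 := by exact_mod_cast hn.ne'
  have hz1 : ‖z‖ = 1 := norm_cw_pow m k
  set c : Fin m → ℂ := fun j => z * cw m ^ (k * (j : ℕ)) with hc
  have hcn : ∀ j, ‖c j‖ = 1 := fun j => by rw [hc, norm_mul, hz1, norm_cw_pow, one_mul]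
  have hp : ∑ j, w j / ((n : ℝ) + 1) = 1 := by rw [← Finset.sum_div, hw, div_self hn.ne']
  have h1 := charFun_step_le (fun j => div_nonneg (hw0 j) hn.le) hp hcn hγ
  have hs1 : ∑ j, (w j / ((n : ℝ) + 1)) • c j = z / ((n : ℂ) + 1) * ucoef m k w := by
    rw [hc, sum_smul_draw]
    push_cast
    rfl
  have hs2 : ∑ j, (w j / ((n : ℝ) + 1)) • c j ^ 2 =
      cw m ^ (2 * k) / ((n : ℂ) + 1) * ucoef m (2 * k) w := by
    have h := sum_smul_draw m (2 * k) w ((n : ℝ) + 1)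
    push_cast at h
    rw [← h]
    refine Finset.sum_congr rfl fun j _ => ?_
    congr 1
    simp only [hc, hzdef, mul_pow, ← pow_mul]
    ring
  have hn1 : ‖(n : ℂ) + 1‖ = (n : ℝ) + 1 := by
    rw [show (n : ℂ) + 1 = ((n : ℝ) + 1 : ℝ) by push_cast; rfl, norm_real, Real.norm_of_nonneg hn.le]
  have hnorm1 : ‖z / ((n : ℂ) + 1) * ucoef m k w‖ ^ 2 = ‖ucoef m k w‖ ^ 2 / ((n : ℝ) + 1) ^ 2 := by
    rw [norm_mul, norm_div, hz1, hn1, mul_pow, div_pow, one_pow]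
    ring
  have hnorm2 : ‖cw m ^ (2 * k) / ((n : ℂ) + 1) * ucoef m (2 * k) w‖ =
      ‖ucoef m (2 * k) w‖ / ((n : ℝ) + 1) := by
    rw [norm_mul, norm_div, norm_cw_pow, hn1]
    ring
  rw [hs1, hs2, hnorm1, hnorm2] at h1
  refine le_trans (le_of_eq ?_) h1
  set e := cexp (I * ((γ * (ucoef m k w / urnProd z n - 1)).re : ℝ)) with he
  have hen : ‖e‖ = 1 := by rw [he, mul_comm, norm_exp_ofReal_mul_I]
  rw [← one_mul ‖_ - cexp _‖, ← hen, ← norm_mul, mul_sub, Finset.mul_sum]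
  congr 1
  rw [mul_comm e (cexp _)]
  congr 1
  refine Finset.sum_congr rfl fun j _ => ?_
  rw [mul_smul_comm, he, ← Complex.exp_add, ← mul_add, ← ofReal_add, ← add_re, ucoef_add_drawVec]
  congr 5
  have hP := urnProd_ne_zero hz n
  have hone := one_add_div_ne_zero hz n
  rw [hθ, urnProd_succ, hc]
  have hone' : (n : ℂ) + 1 + z ≠ 0 := by
    intro h
    apply hone
    field_simp
    simpa using h
  field_simp
  ring

lemma charFun_succ_sub_le (hR : IsCyclicUrn μ m j0 R) (k n : ℕ) (hz : 0 < (cw m ^ k).re) {γ : ℂ}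
    (hγ : ‖γ / urnProd (cw m ^ k) (n + 1)‖ ≤ 1 / 2) :
    ‖∫ ω, cexp (I * ((γ * (ucoef m k (R (n + 1) ω) / urnProd (cw m ^ k) (n + 1) - 1)).re : ℝ)) ∂μ -
      cexp (-(‖γ / urnProd (cw m ^ k) (n + 1)‖ ^ 2 / 4 : ℝ)) *
        ∫ ω, cexp (I * ((γ * (ucoef m k (R n ω) / urnProd (cw m ^ k) n - 1)).re : ℝ)) ∂μ‖ ≤
      4 * ‖γ / urnProd (cw m ^ k) (n + 1)‖ ^ 3 + ‖γ / urnProd (cw m ^ k) (n + 1)‖ ^ 2 *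
        ((∫ ω, ‖ucoef m k (R n ω)‖ ^ 2 ∂μ) / ((n : ℝ) + 1) ^ 2 +
          (∫ ω, ‖ucoef m (2 * k) (R n ω)‖ ∂μ) / ((n : ℝ) + 1)) := by
  have := hR.isProb
  have hc1 := continuous_ucoef m k
  have hc2 := continuous_ucoef m (2 * k)
  have i1 := urn_integrable hR n (G := fun w => ‖ucoef m k w‖ ^ 2) (by fun_prop)
  have i2 := urn_integrable hR n (G := fun w => ‖ucoef m (2 * k) w‖) (by fun_prop)
  have ci := fun (γ P : ℂ) => continuous_charFun_integrand (m := m) k γ P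
  set P := urnProd (cw m ^ k) (n + 1) with hP
  have i3 := urn_integrable hR n (ci γ (urnProd (cw m ^ k) n))
  have i4 := urn_integrable hR n (G := fun w => ∑ j, (w j / ((n : ℝ) + 1)) • cexp (I * ((γ *
    (ucoef m k (fun i => w i + drawVec m j i) / P - 1)).re : ℝ))) (by
      refine continuous_finsetSum _ fun j _ => ?_
      exact ((continuous_apply j).div_const _).smul ((ci γ P).comp
        (continuous_id.add continuous_const)))
  rw [urn_integral_succ hR n (ci γ P), ← integral_const_mul, ← integral_sub i4 (i3.const_mul _)]
  refine (norm_integral_le_integral_norm _).trans ?_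
  rw [← integral_div, ← integral_div, ← integral_add (i1.div_const _) (i2.div_const _),
    ← integral_const_mul]
  have i5 : Integrable (fun ω => ‖γ / P‖ ^ 2 * (‖ucoef m k (R n ω)‖ ^ 2 / ((n : ℝ) + 1) ^ 2 +
      ‖ucoef m (2 * k) (R n ω)‖ / ((n : ℝ) + 1))) μ :=
    ((i1.div_const _).add (i2.div_const _)).const_mul _
  have hconst : 4 * ‖γ / P‖ ^ 3 = ∫ _, 4 * ‖γ / P‖ ^ 3 ∂μ := by simp
  rw [hconst, ← integral_add (integrable_const _) i5]
  refine integral_mono_ae (i4.sub (i3.const_mul _)).norm ((integrable_const _).add i5) ?_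
  filter_upwards [urn_sum hR n] with ω hω
  exact norm_sum_cexp_draw_sub_le k n hz (urn_nonneg hR n ω) hω hγ

lemma exists_charFun_bound (hR : IsCyclicUrn μ m j0 R) (hj : (j0 : ℕ) = 0) (k : ℕ)
    (hz : (cw m ^ k).re = 1 / 2) (hz2 : (cw m ^ (2 * k)).re < 1 / 2) :
    ∃ r > 0, ∃ K, ∀ γ : ℂ, ‖γ‖ ≤ r → ∀ N : ℕ,
      ‖∫ ω, cexp (I * ((γ * (ucoef m k (R N ω) / urnProd (cw m ^ k) N - 1)).re : ℝ)) ∂μ -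
        cexp (-(‖γ‖ ^ 2 * (∑ j ∈ Finset.range N, (‖urnProd (cw m ^ k) (j + 1)‖ ^ 2)⁻¹) / 4 : ℝ))‖ ≤
        K * ‖γ‖ ^ 2 := by
  have := hR.isProb
  have hz0 : 0 < (cw m ^ k).re := by rw [hz]; norm_num
  obtain ⟨c, C, hc, hC, hcC⟩ := urnProd_norm_bounds hz0 (norm_cw_pow m k).le
  obtain ⟨K1, hK1, hb1⟩ := exists_second_moment_le hR k 0 (p := 3 / 2) (by norm_num)
    (by rw [hz]; norm_num)
  obtain ⟨K2, hK2, hb2⟩ := integral_norm_le_of_re_lt hR (2 * k) hz2 0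
  simp only [zero_mul, sub_zero] at hb1 hb2
  set P := urnProd (cw m ^ k) with hP
  set g : ℕ → ℝ := fun j => ((j : ℝ) + 1) ^ (-(3 / 2) : ℝ) with hg
  have hg0 : ∀ j, 0 ≤ g j := fun j => by simp only [hg]; positivity
  have hgs : Summable g := by
    have h := (summable_nat_add_iff 1).2 (Real.summable_nat_rpow (p := -(3 / 2)).2 (by norm_num))
    simpa [hg] using h
  set K := 4 / c ^ 3 + (K1 + K2) / c ^ 2 with hK
  have hK0 : 0 ≤ K := by positivity
  refine ⟨min (c / 2) 1, by positivity, K * ∑' j, g j, fun γ hγ N => ?_⟩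
  have hγ1 : ‖γ‖ ≤ 1 := hγ.trans (min_le_right _ _)
  have hγ2 : ‖γ‖ ≤ c / 2 := hγ.trans (min_le_left _ _)
  have hγ0 := norm_nonneg γ
  have key : ∀ N : ℕ,
      ‖∫ ω, cexp (I * ((γ * (ucoef m k (R N ω) / P N - 1)).re : ℝ)) ∂μ -
        cexp (-(‖γ‖ ^ 2 * (∑ j ∈ Finset.range N, (‖P (j + 1)‖ ^ 2)⁻¹) / 4 : ℝ))‖ ≤
        K * ‖γ‖ ^ 2 * ∑ j ∈ Finset.range N, g j := by
    intro N
    induction N with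
    | zero => simp [hP, ucoef_init hR hj]
    | succ n ih =>
      set s := √((n : ℝ) + 1) with hs
      have hn : (0 : ℝ) < (n : ℝ) + 1 := by positivity
      have hs0 : 0 < s := Real.sqrt_pos.2 hn
      have hs1 : 1 ≤ s := by rw [hs, Real.one_le_sqrt]; linarith [n.cast_nonneg (α := ℝ)]
      have hss : s ^ 2 = (n : ℝ) + 1 := Real.sq_sqrt hn.le
      have hgn : g n = (s ^ 3)⁻¹ := by
        simp only [hg]
        rw [hs, Real.rpow_neg hn.le, Real.sqrt_eq_rpow, ← Real.rpow_natCast, ← Real.rpow_mul hn.le]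
        norm_num
      have hθ : ‖γ / P (n + 1)‖ ≤ ‖γ‖ / (c * s) := by
        have h := (hcC (n + 1) (by omega)).1
        rw [hz, ← Real.sqrt_eq_rpow] at h
        push_cast at h
        rw [norm_div]
        gcongr
      have hθ2 : ‖γ / P (n + 1)‖ ≤ 1 / 2 := by
        refine hθ.trans ?_
        rw [div_le_iff₀ (by positivity)]
        nlinarith
      have hst := charFun_succ_sub_le hR k n hz0 hθ2
      rw [← hP] at hst
      have e1 : (∫ ω, ‖ucoef m k (R n ω)‖ ^ 2 ∂μ) / ((n : ℝ) + 1) ^ 2 ≤ K1 / s := by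
        have h := hb1 n
        have h32 : ((n : ℝ) + 1) ^ (3 / 2 : ℝ) = s ^ 3 := by
          rw [hs, Real.sqrt_eq_rpow, ← Real.rpow_natCast, ← Real.rpow_mul hn.le]
          norm_num
        rw [h32] at h
        rw [← hss, div_le_div_iff₀ (by positivity) hs0]
        calc _ ≤ K1 * s ^ 3 * s := by gcongr
          _ = _ := by ring
      have e2 : (∫ ω, ‖ucoef m (2 * k) (R n ω)‖ ∂μ) / ((n : ℝ) + 1) ≤ K2 / s := by
        have h := hb2 n
        rw [← hs] at h
        rw [← hss, div_le_div_iff₀ (by positivity) hs0]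
        calc _ ≤ K2 * s * s := by gcongr
          _ = _ := by ring
      have hstep : 4 * ‖γ / P (n + 1)‖ ^ 3 + ‖γ / P (n + 1)‖ ^ 2 *
          ((∫ ω, ‖ucoef m k (R n ω)‖ ^ 2 ∂μ) / ((n : ℝ) + 1) ^ 2 +
          (∫ ω, ‖ucoef m (2 * k) (R n ω)‖ ∂μ) / ((n : ℝ) + 1)) ≤ K * ‖γ‖ ^ 2 * g n := by
        calc _ ≤ 4 * (‖γ‖ / (c * s)) ^ 3 + (‖γ‖ / (c * s)) ^ 2 * (K1 / s + K2 / s) := by gcongr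
          _ = 4 / (c ^ 3 * s ^ 3) * (‖γ‖ ^ 2 * ‖γ‖) +
              ‖γ‖ ^ 2 * ((K1 + K2) / (c ^ 2 * s ^ 3)) := by
            field_simp
          _ ≤ 4 / (c ^ 3 * s ^ 3) * (‖γ‖ ^ 2 * 1) +
              ‖γ‖ ^ 2 * ((K1 + K2) / (c ^ 2 * s ^ 3)) := by gcongr
          _ = K * ‖γ‖ ^ 2 * g n := by
            rw [hgn, hK]
            field_simp
      have hexp : cexp (-(‖γ‖ ^ 2 * (∑ j ∈ Finset.range (n + 1), (‖P (j + 1)‖ ^ 2)⁻¹) / 4 : ℝ)) =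
          cexp (-(‖γ / P (n + 1)‖ ^ 2 / 4 : ℝ)) *
          cexp (-(‖γ‖ ^ 2 * (∑ j ∈ Finset.range n, (‖P (j + 1)‖ ^ 2)⁻¹) / 4 : ℝ)) := by
        rw [← Complex.exp_add, Finset.sum_range_succ, norm_div]
        congr 1
        push_cast
        ring
      have hle1 : ‖cexp (-(‖γ / P (n + 1)‖ ^ 2 / 4 : ℝ))‖ ≤ 1 := by
        rw [← ofReal_neg, norm_exp_ofReal, Real.exp_le_one_iff]
        have := sq_nonneg ‖γ / P (n + 1)‖
        linarith
      rw [hexp, Finset.sum_range_succ, mul_add, add_comm (K * _ * _)]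
      refine (norm_sub_le_norm_sub_add_norm_sub _ (cexp (-(‖γ / P (n + 1)‖ ^ 2 / 4 : ℝ)) *
        ∫ ω, cexp (I * ((γ * (ucoef m k (R n ω) / P n - 1)).re : ℝ)) ∂μ) _).trans ?_
      refine add_le_add (hst.trans hstep) ?_
      rw [← mul_sub, norm_mul]
      calc _ ≤ 1 * (K * ‖γ‖ ^ 2 * ∑ j ∈ Finset.range n, g j) := by gcongr
        _ = _ := one_mul _
  refine (key N).trans ?_
  calc _ ≤ K * ‖γ‖ ^ 2 * ∑' j, g j := by
        gcongr
        exact hgs.sum_le_tsum _ fun j _ => hg0 j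
    _ = _ := by ring

end Critical

lemma exists_tendsto_urnProd_div_cpow {z : ℂ} (hz : 0 < z.re) (hz1 : ‖z‖ ≤ 1) :
    ∃ b, b ≠ 0 ∧ Tendsto (fun n : ℕ => urnProd z n / (n : ℂ) ^ z) atTop (𝓝 b) := by
  obtain ⟨b, hb, C, _, h⟩ := urnProd_asymp hz hz1
  refine ⟨b, hb, tendsto_iff_norm_sub_tendsto_zero.2 ?_⟩
  refine squeeze_zero' (Eventually.of_forall fun n => norm_nonneg _)
    ((eventually_ge_atTop 1).mono fun n hn => h n hn) ?_
  exact tendsto_const_nhds.div_atTop tendsto_natCast_atTop_atTop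

section CriticalLimit

variable {Ω : Type*} [MeasurableSpace Ω] {μ : Measure Ω} {m : ℕ} {j0 : Fin m}
  {R : ℕ → Ω → Fin m → ℝ}

/-- The critical mode satisfies a central limit theorem with scaling `√(n log n)`. -/
lemma tendsto_charFun_critical (hR : IsCyclicUrn μ m j0 R) (hj : (j0 : ℕ) = 0) (k : ℕ)
    (hz : (cw m ^ k).re = 1 / 2) (hz2 : (cw m ^ (2 * k)).re < 1 / 2) (c : ℂ) :
    Tendsto (fun N : ℕ => ∫ ω, cexp (I * (((√(N * Real.log N))⁻¹ *
      (c * (ucoef m k (R N ω) - urnProd (cw m ^ k) N)).re : ℝ) : ℂ)) ∂μ) atTop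
      (𝓝 (cexp (-(‖c‖ ^ 2 / 4 : ℝ)))) := by
  obtain ⟨r, hr, K, h⟩ := exists_charFun_bound hR hj k hz hz2
  set z := cw m ^ k with hzdef
  have hz0 : 0 < z.re := by rw [hz]; norm_num
  obtain ⟨b, hb, hlim⟩ := exists_tendsto_urnProd_div_cpow hz0 (norm_cw_pow m k).le
  have hsum := sum_inv_norm_urnProd_sq_div_log hz hb hlim
  set γ : ℕ → ℂ := fun N => c * urnProd z N * ((√(N * Real.log N))⁻¹ : ℝ) with hγ
  have hlog : Tendsto (fun N : ℕ => Real.log N) atTop atTop :=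
    Real.tendsto_log_atTop.comp tendsto_natCast_atTop_atTop
  have hγsq : ∀ᶠ N : ℕ in atTop,
      ‖γ N‖ ^ 2 = ‖c‖ ^ 2 * ‖urnProd z N / (N : ℂ) ^ z‖ ^ 2 / Real.log N := by
    filter_upwards [eventually_ge_atTop 2] with N hN
    have hN0 : (0 : ℝ) < N := by positivity
    have hl : 0 < Real.log N := Real.log_pos (by exact_mod_cast hN)
    have hnz : ‖(N : ℂ) ^ z‖ ^ 2 = N := by
      rw [norm_natCast_cpow_of_pos (by omega), hz, ← Real.sqrt_eq_rpow, Real.sq_sqrt hN0.le]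
    rw [hγ, norm_mul, norm_mul, norm_div, div_pow, hnz, norm_real, norm_inv,
      Real.norm_of_nonneg (Real.sqrt_nonneg _), mul_pow, mul_pow, inv_pow,
      Real.sq_sqrt (by positivity)]
    field_simp
  have hQ : Tendsto (fun N : ℕ => ‖c‖ ^ 2 * ‖urnProd z N / (N : ℂ) ^ z‖ ^ 2) atTop
      (𝓝 (‖c‖ ^ 2 * ‖b‖ ^ 2)) := (hlim.norm.pow 2).const_mul _
  have hγ2 : Tendsto (fun N => ‖γ N‖ ^ 2) atTop (𝓝 0) :=
    (hQ.div_atTop hlog).congr' (hγsq.mono fun N hN => hN.symm)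
  have hγ0 : ∀ᶠ N in atTop, ‖γ N‖ ≤ r := by
    filter_upwards [hγ2.eventually (gt_mem_nhds (show (0 : ℝ) < r ^ 2 by positivity))] with N hN
    exact (pow_lt_pow_iff_left₀ (norm_nonneg _) hr.le two_ne_zero).1 hN |>.le
  have hvar : Tendsto (fun N => ‖γ N‖ ^ 2 *
      (∑ j ∈ Finset.range N, (‖urnProd z (j + 1)‖ ^ 2)⁻¹)) atTop (𝓝 (‖c‖ ^ 2)) := by
    have h1 := hQ.mul hsum
    rw [mul_assoc, mul_inv_cancel₀ (by positivity), mul_one] at h1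
    refine h1.congr' (hγsq.mono fun N hN => ?_)
    simp only [hN]
    ring
  have hexp : Tendsto (fun N => cexp (-(‖γ N‖ ^ 2 *
      (∑ j ∈ Finset.range N, (‖urnProd z (j + 1)‖ ^ 2)⁻¹) / 4 : ℝ))) atTop
      (𝓝 (cexp (-(‖c‖ ^ 2 / 4 : ℝ)))) :=
    (Complex.continuous_exp.tendsto _).comp
      ((continuous_ofReal.tendsto _).comp (hvar.div_const 4)).neg
  have hdiff := squeeze_zero_norm' (hγ0.mono fun N hN => h (γ N) hN N)
    (by simpa using hγ2.const_mul K)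
  have := hdiff.add hexp
  rw [zero_add] at this
  refine this.congr fun N => ?_
  rw [sub_add_cancel]
  congr with ω
  congr 3
  rw [← re_ofReal_mul]
  congr 1
  have hP := urnProd_ne_zero hz0 N
  simp only [hγ]
  field_simp

end CriticalLimit

lemma isPrimitiveRoot_cw {m : ℕ} (hm : m ≠ 0) : IsPrimitiveRoot (cw m) m :=
  Complex.isPrimitiveRoot_exp m hm

lemma vvec_eq (m k : ℕ) (t : Fin m) :
    vvec m k t = (m : ℂ)⁻¹ * (starRingEnd ℂ) (cw m ^ (k * (t : ℕ))) := by
  rw [vvec, zpow_neg, zpow_natCast, inv_eq_conj (norm_cw_pow _ _)]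

lemma cw_pow_sub_mul {m k : ℕ} (hk : k ≤ m) (hm : m ≠ 0) (t : ℕ) :
    cw m ^ ((m - k) * t) = (starRingEnd ℂ) (cw m ^ (k * t)) := by
  rw [← inv_eq_conj (norm_cw_pow _ _)]
  refine eq_inv_of_mul_eq_one_left ?_
  rw [← pow_add, ← add_mul, Nat.sub_add_cancel hk, pow_mul, cw_pow_self hm, one_pow]

lemma vvec_sub {m k : ℕ} (hk : k ≤ m) (t : Fin m) :
    vvec m (m - k) t = (starRingEnd ℂ) (vvec m k t) := by
  rw [vvec_eq, vvec_eq, cw_pow_sub_mul hk t.pos.ne', map_mul, map_inv₀, conj_natCast]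

lemma ucoef_sub_index {m k : ℕ} (hk : k ≤ m) (hm : m ≠ 0) (w : Fin m → ℝ) :
    ucoef m (m - k) w = (starRingEnd ℂ) (ucoef m k w) := by
  simp only [ucoef, map_sum, map_mul, conj_ofReal, cw_pow_sub_mul hk hm]

lemma norm_vvec_le (m k : ℕ) (t : Fin m) : ‖vvec m k t‖ ≤ 1 := by
  have hm : (1 : ℝ) ≤ m := by exact_mod_cast t.pos
  rw [vvec_eq, norm_mul, RCLike.norm_conj, norm_cw_pow, mul_one, norm_inv, norm_natCast]
  exact inv_le_one_of_one_le₀ hm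

/-- Inversion of the discrete Fourier transform. -/
lemma sum_ucoef_mul_vvec {m : ℕ} (w : Fin m → ℝ) (i : Fin m) :
    ∑ k ∈ Finset.range m, ucoef m k w * vvec m k i = w i := by
  have hm : m ≠ 0 := i.pos.ne'
  have hmC : (m : ℂ) ≠ 0 := by exact_mod_cast hm
  have hcw0 : cw m ≠ 0 := norm_ne_zero_iff.1 (by rw [norm_cw]; exact one_ne_zero)
  have hgeom : ∀ t : Fin m, ∑ k ∈ Finset.range m, (cw m ^ (t : ℕ) / cw m ^ (i : ℕ)) ^ k =
      if t = i then (m : ℂ) else 0 := by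
    intro t
    split_ifs with h
    · rw [h, div_self (pow_ne_zero _ hcw0)]
      simp
    · have hne : cw m ^ (t : ℕ) / cw m ^ (i : ℕ) ≠ 1 := by
        rw [Ne, div_eq_one_iff_eq (pow_ne_zero _ hcw0)]
        exact fun h' => h (Fin.ext ((isPrimitiveRoot_cw hm).pow_inj t.2 i.2 h'))
      rw [geom_sum_eq hne, div_pow, ← pow_mul, ← pow_mul, mul_comm (t : ℕ), mul_comm (i : ℕ),
        pow_mul, pow_mul, cw_pow_self hm]
      simp
  calc ∑ k ∈ Finset.range m, ucoef m k w * vvec m k i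
      = ∑ t : Fin m, (w t : ℂ) * (m : ℂ)⁻¹ *
          ∑ k ∈ Finset.range m, (cw m ^ (t : ℕ) / cw m ^ (i : ℕ)) ^ k := by
        simp only [ucoef, Finset.sum_mul, Finset.mul_sum]
        rw [Finset.sum_comm]
        refine Finset.sum_congr rfl fun t _ => Finset.sum_congr rfl fun k _ => ?_
        rw [vvec_eq, ← inv_eq_conj (norm_cw_pow _ _), div_pow, ← pow_mul, ← pow_mul,
          mul_comm (t : ℕ), mul_comm (i : ℕ)]
        ring
    _ = w i := by
        simp only [hgeom, mul_ite, mul_zero, Finset.sum_ite_eq', Finset.mem_univ, if_true]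
        field_simp

lemma sum_range_six_mul {q : ℕ} (hq : 1 ≤ q) {f : ℕ → ℝ} (h0 : f 0 = 0)
    (hf : ∀ k ≤ 6 * q, f (6 * q - k) = f k) :
    ∑ k ∈ Finset.range (6 * q), f k = ∑ k ∈ Finset.Ico 1 q, 2 * f k + 2 * f q +
      ∑ k ∈ Finset.Ioo q (5 * q), f k := by
  have e1 : ∑ k ∈ Finset.Ico (5 * q + 1) (6 * q), f k = ∑ k ∈ Finset.Ico 1 q, f k := by
    have h := Finset.sum_Ico_reflect f (m := q) (n := 6 * q) 1 (by omega)
    rw [show 6 * q + 1 - q = 5 * q + 1 by omega, show 6 * q + 1 - 1 = 6 * q by omega] at h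
    rw [← h]
    exact Finset.sum_congr rfl fun k hk => hf k (by have := Finset.mem_Ico.1 hk; omega)
  have e2 : f (5 * q) = f q := by rw [← hf q (by omega)]; congr 1; omega
  have e3 : Finset.Ioo q (5 * q) = Finset.Ico (q + 1) (5 * q) := by
    ext k; simp only [Finset.mem_Ioo, Finset.mem_Ico]; omega
  rw [Finset.range_eq_Ico, ← Finset.sum_Ico_consecutive f (Nat.zero_le q) (by omega : q ≤ 6 * q),
    Finset.sum_eq_sum_Ico_succ_bot (by omega : 0 < q), h0,
    Finset.sum_eq_sum_Ico_succ_bot (by omega : q < 6 * q),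
    ← Finset.sum_Ico_consecutive f (by omega : q + 1 ≤ 5 * q) (by omega : 5 * q ≤ 6 * q),
    Finset.sum_eq_sum_Ico_succ_bot (by omega : 5 * q < 6 * q), e1, e2, e3, ← Finset.mul_sum]
  ring

lemma half_lt_re_cw_pow {q k : ℕ} (hk : k < q) : 1 / 2 < (cw (6 * q) ^ k).re := by
  have hq : (0 : ℝ) < q := by exact_mod_cast (by omega : 0 < q)
  have hk' : (k : ℝ) < q := by exact_mod_cast hk
  have hpi := Real.pi_pos
  rw [cw_pow_re, ← Real.cos_pi_div_three]
  refine Real.cos_lt_cos_of_nonneg_of_le_pi (by positivity) (by linarith) ?_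
  push_cast
  rw [div_lt_div_iff₀ (by positivity) (by norm_num)]
  nlinarith

lemma re_cw_pow_eq_half {q : ℕ} (hq : 1 ≤ q) : (cw (6 * q) ^ q).re = 1 / 2 := by
  have hq' : (q : ℝ) ≠ 0 := by exact_mod_cast (by omega : q ≠ 0)
  rw [cw_pow_re, ← Real.cos_pi_div_three]
  congr 1
  push_cast
  field_simp
  norm_num

lemma re_cw_pow_lt_half {q k : ℕ} (hk : q < k) (hk5 : k < 5 * q) :
    (cw (6 * q) ^ k).re < 1 / 2 := by
  have hq : (0 : ℝ) < q := by exact_mod_cast (by omega : 0 < q)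
  have hk1 : (q : ℝ) < k := by exact_mod_cast hk
  have hk2 : (k : ℝ) < 5 * q := by exact_mod_cast hk5
  have hpi := Real.pi_pos
  rw [cw_pow_re, ← Real.cos_pi_div_three]
  push_cast
  have h1 : Real.pi / 3 < 2 * Real.pi * k / (6 * q) := by
    rw [div_lt_div_iff₀ (by norm_num) (by positivity)]
    nlinarith
  have h2 : 2 * Real.pi * k / (6 * q) < 2 * Real.pi - Real.pi / 3 := by
    rw [div_lt_iff₀ (by positivity)]
    nlinarith
  rcases le_total (2 * Real.pi * k / (6 * q)) Real.pi with h | h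
  · exact Real.cos_lt_cos_of_nonneg_of_le_pi (by positivity) h h1
  · rw [← Real.cos_two_pi_sub]
    exact Real.cos_lt_cos_of_nonneg_of_le_pi (by positivity) (by linarith) (by linarith)

section Decomposition

variable {Ω : Type*} [MeasurableSpace Ω] {μ : Measure Ω} {q : ℕ} {j0 : Fin (6 * q)}
  {R : ℕ → Ω → Fin (6 * q) → ℝ}

lemma ucoef_zero_sub_urnProd_eq_zero (hR : IsCyclicUrn μ (6 * q) j0 R) (n : ℕ) :
    ∀ᵐ ω ∂μ, ucoef (6 * q) 0 (R n ω) - urnProd (cw (6 * q) ^ 0) n = 0 := by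
  filter_upwards [urn_sum hR n] with ω hω
  have h1 : ucoef (6 * q) 0 (R n ω) = n + 1 := by
    simp only [ucoef, zero_mul, pow_zero, one_mul]
    exact_mod_cast hω
  have h2 : ∀ n, urnProd (cw (6 * q) ^ 0) n = n + 1 := by
    intro n
    induction n with
    | zero => simp
    | succ n ih =>
      have : (n : ℂ) + 1 ≠ 0 := by exact_mod_cast n.succ_ne_zero
      rw [urnProd_succ, ih, pow_zero]
      push_cast
      field_simp
  rw [h1, h2, sub_self]

lemma urn_decomposition (hR : IsCyclicUrn μ (6 * q) j0 R) (hj : (j0 : ℕ) = 0) (n : ℕ) :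
    ∀ᵐ ω ∂μ, ∀ i, R n ω i - expVec μ (R n) i =
      ∑ k ∈ Finset.Ico 1 q, 2 * ((ucoef (6 * q) k (R n ω) - urnProd (cw (6 * q) ^ k) n) *
        vvec (6 * q) k i).re +
      2 * ((ucoef (6 * q) q (R n ω) - urnProd (cw (6 * q) ^ q) n) * vvec (6 * q) q i).re +
      ∑ k ∈ Finset.Ioo q (5 * q), ((ucoef (6 * q) k (R n ω) - urnProd (cw (6 * q) ^ k) n) *
        vvec (6 * q) k i).re := by
  have hm : 6 * q ≠ 0 := j0.pos.ne'
  filter_upwards [ucoef_zero_sub_urnProd_eq_zero hR n] with ω hω i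
  have hU : ∀ k, ucoef (6 * q) k (R n ω) - urnProd (cw (6 * q) ^ k) n =
      ucoef (6 * q) k (fun t => R n ω t - expVec μ (R n) t) := fun k => by
    rw [ucoef_sub, ucoef_expVec hR hj]
  rw [hU] at hω
  simp only [hU]
  have h := sum_ucoef_mul_vvec (fun t => R n ω t - expVec μ (R n) t) i
  rw [← sum_range_six_mul (by omega : 1 ≤ q) (f := fun k =>
      (ucoef (6 * q) k (fun t => R n ω t - expVec μ (R n) t) * vvec (6 * q) k i).re), ← re_sum, h,
    ofReal_re]
  · simp [hω]
  · intro k hk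
    simp only [ucoef_sub_index hk hm, vvec_sub hk, ← map_mul, conj_re]

/-- After removing the supercritical modes, only the critical mode is larger than `√n`. -/
lemma exists_supercritical_limits (hR : IsCyclicUrn μ (6 * q) j0 R) (hj : (j0 : ℕ) = 0) :
    ∃ Ξ : ℕ → Ω → ℂ, (∀ k, StronglyMeasurable (Ξ k)) ∧ (∀ k, Integrable (Ξ k) μ) ∧
      ∃ K : ℝ, ∀ n : ℕ, 1 ≤ n → ∀ i,
        ∫ ω, |R n ω i - expVec μ (R n) i -
          ∑ k ∈ Finset.Ico 1 q, 2 * ((n : ℂ) ^ (cw (6 * q) ^ k) * Ξ k ω * vvec (6 * q) k i).re -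
          2 * ((ucoef (6 * q) q (R n ω) - urnProd (cw (6 * q) ^ q) n) * vvec (6 * q) q i).re| ∂μ ≤
        K * √((n : ℝ) + 1) := by
  have := hR.isProb
  have hsup : ∀ k, ∃ Ξ : Ω → ℂ, StronglyMeasurable Ξ ∧ Integrable Ξ μ ∧ ∃ K : ℝ,
      k ∈ Finset.Ico 1 q → ∀ n : ℕ, 1 ≤ n →
      ∫ ω, ‖ucoef (6 * q) k (R n ω) - urnProd (cw (6 * q) ^ k) n -
        (n : ℂ) ^ (cw (6 * q) ^ k) * Ξ ω‖ ∂μ ≤ K * √((n : ℝ) + 1) := by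
    intro k
    by_cases hk : k ∈ Finset.Ico 1 q
    · obtain ⟨Ξ, h1, h2, K, hK⟩ :=
        exists_limit_of_re_gt hR k (half_lt_re_cw_pow (Finset.mem_Ico.1 hk).2)
      refine ⟨Ξ, h1, h2, |K|, fun _ n hn => (hK n hn).trans ?_⟩
      gcongr
      · exact le_abs_self K
      · linarith
    · exact ⟨0, stronglyMeasurable_zero, integrable_zero _ _ _, 0, fun h => absurd h hk⟩
  have hsub : ∀ k, ∃ K : ℝ, k ∈ Finset.Ioo q (5 * q) → ∀ n : ℕ,
      ∫ ω, ‖ucoef (6 * q) k (R n ω) - urnProd (cw (6 * q) ^ k) n‖ ∂μ ≤ K * √((n : ℝ) + 1) := by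
    intro k
    by_cases hk : k ∈ Finset.Ioo q (5 * q)
    · obtain ⟨K, _, hK⟩ := integral_norm_le_of_re_lt hR k
        (re_cw_pow_lt_half (Finset.mem_Ioo.1 hk).1 (Finset.mem_Ioo.1 hk).2) 1
      exact ⟨K, fun _ n => by simpa using hK n⟩
    · exact ⟨0, fun h => absurd h hk⟩
  choose Ξ hΞm hΞi K1 hK1 using hsup
  choose K2 hK2 using hsub
  refine ⟨Ξ, hΞm, hΞi, ∑ k ∈ Finset.Ico 1 q, 2 * K1 k + ∑ k ∈ Finset.Ioo q (5 * q), K2 k,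
    fun n hn i => ?_⟩
  have hi0 : ∀ k, Integrable (fun ω => ucoef (6 * q) k (R n ω) - urnProd (cw (6 * q) ^ k) n) μ :=
    fun k => (urn_integrable hR n (continuous_ucoef _ k)).sub (integrable_const _)
  have hi1 : ∀ k, Integrable (fun ω => 2 * ‖ucoef (6 * q) k (R n ω) - urnProd (cw (6 * q) ^ k) n -
      (n : ℂ) ^ (cw (6 * q) ^ k) * Ξ k ω‖) μ :=
    fun k => (((hi0 k).sub ((hΞi k).const_mul _)).norm).const_mul 2
  calc _ ≤ ∫ ω, (∑ k ∈ Finset.Ico 1 q, 2 * ‖ucoef (6 * q) k (R n ω) - urnProd (cw (6 * q) ^ k) n -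
          (n : ℂ) ^ (cw (6 * q) ^ k) * Ξ k ω‖ + ∑ k ∈ Finset.Ioo q (5 * q),
          ‖ucoef (6 * q) k (R n ω) - urnProd (cw (6 * q) ^ k) n‖) ∂μ := by
        refine integral_mono_of_nonneg (Eventually.of_forall fun ω => abs_nonneg _)
          ((integrable_finsetSum _ fun k _ => hi1 k).add
            (integrable_finsetSum _ fun k _ => (hi0 k).norm)) ?_
        filter_upwards [urn_decomposition hR hj n] with ω hω
        have hre : ∀ (z : ℂ) (k : ℕ), |(z * vvec (6 * q) k i).re| ≤ ‖z‖ := fun z k =>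
          (abs_re_le_norm _).trans ((norm_mul_le _ _).trans
            (mul_le_of_le_one_right (norm_nonneg _) (norm_vvec_le _ _ _)))
        rw [hω i, add_right_comm, add_sub_right_comm, add_sub_cancel_right, add_sub_right_comm,
          ← Finset.sum_sub_distrib]
        refine (abs_add_le _ _).trans (add_le_add ?_ ?_)
        · refine (Finset.abs_sum_le_sum_abs _ _).trans (Finset.sum_le_sum fun k _ => ?_)
          rw [← mul_sub, ← sub_re, ← sub_mul, abs_mul, abs_two]
          gcongr
          exact hre _ k
        · exact (Finset.abs_sum_le_sum_abs _ _).trans (Finset.sum_le_sum fun k _ => hre _ k)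
    _ = ∑ k ∈ Finset.Ico 1 q, 2 * ∫ ω, ‖ucoef (6 * q) k (R n ω) - urnProd (cw (6 * q) ^ k) n -
          (n : ℂ) ^ (cw (6 * q) ^ k) * Ξ k ω‖ ∂μ + ∑ k ∈ Finset.Ioo q (5 * q),
          ∫ ω, ‖ucoef (6 * q) k (R n ω) - urnProd (cw (6 * q) ^ k) n‖ ∂μ := by
        rw [integral_add (integrable_finsetSum _ fun k _ => hi1 k)
          (integrable_finsetSum _ fun k _ => (hi0 k).norm), integral_finsetSum _ fun k _ => hi1 k,
          integral_finsetSum _ fun k _ => (hi0 k).norm]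
        simp only [integral_const_mul]
    _ ≤ ∑ k ∈ Finset.Ico 1 q, 2 * (K1 k * √((n : ℝ) + 1)) + ∑ k ∈ Finset.Ioo q (5 * q),
          K2 k * √((n : ℝ) + 1) := by
        gcongr with k hk k hk
        · exact hK1 k hk n hn
        · exact hK2 k hk n
    _ = _ := by
        rw [add_mul, Finset.sum_mul, Finset.sum_mul]
        simp only [mul_assoc]

end Decomposition

/-- The centered Gaussian distribution on `Fin d → ℝ` with covariance matrix `S`. -/
def centeredGaussian {d : ℕ} (S : Matrix (Fin d) (Fin d) ℝ) : Measure (Fin d → ℝ) :=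
  (multivariateGaussian 0 S).map (WithLp.ofLp : EuclideanSpace ℝ (Fin d) → Fin d → ℝ)

lemma dotProduct_mulVec_eq_sum {d : ℕ} (S : Matrix (Fin d) (Fin d) ℝ) (l : Fin d → ℝ) :
    l ⬝ᵥ S.mulVec l = ∑ i, ∑ j, l i * S i j * l j := by
  simp only [dotProduct, Matrix.mulVec, Finset.mul_sum, mul_assoc]

lemma isCenteredGaussian_centeredGaussian {d : ℕ} {S : Matrix (Fin d) (Fin d) ℝ}
    (hS : S.PosSemidef) : IsCenteredGaussian (centeredGaussian S) S := by
  have hof : Measurable (WithLp.ofLp : EuclideanSpace ℝ (Fin d) → Fin d → ℝ) :=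
    WithLp.measurable_ofLp ..
  have hprob : IsProbabilityMeasure (centeredGaussian S) :=
    Measure.isProbabilityMeasure_map hof.aemeasurable
  refine ⟨hprob, fun l => ?_⟩
  have hl : Measurable fun x : Fin d → ℝ => ∑ i, l i * x i := by fun_prop
  have := Measure.isProbabilityMeasure_map (μ := centeredGaussian S) hl.aemeasurable
  refine Measure.ext_of_charFun (funext fun t => ?_)
  rw [charFun_gaussianReal, charFun_apply_real, integral_map hl.aemeasurable (by fun_prop),
    centeredGaussian, integral_map hof.aemeasurable (by
      have : Continuous fun x : Fin d → ℝ => cexp ((t : ℂ) * ((∑ i, l i * x i : ℝ) : ℂ) * I) := by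
        fun_prop
      exact this.aestronglyMeasurable)]
  have h := charFun_multivariateGaussian (μ := 0) hS (WithLp.toLp 2 (t • l))
  rw [charFun_apply] at h
  convert h using 1
  · congr with x
    congr 2
    rw [PiLp.inner_apply, ← ofReal_mul, Finset.mul_sum]
    congr 1
    refine Finset.sum_congr rfl fun i _ => ?_
    simp
    ring
  · have hq : 0 ≤ ∑ i, ∑ j, l i * S i j * l j := by
      rw [← dotProduct_mulVec_eq_sum]
      simpa using hS.dotProduct_mulVec_nonneg l
    rw [Real.coe_toNNReal _ hq, ← dotProduct_mulVec_eq_sum]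
    congr 1
    simp [Matrix.mulVec_smul]
    ring

lemma tendstoInDist_centeredGaussian {Ω : Type*} [MeasurableSpace Ω] {μ : Measure Ω}
    [IsProbabilityMeasure μ] {d : ℕ} {S : Matrix (Fin d) (Fin d) ℝ} (hS : S.PosSemidef)
    {X : ℕ → Ω → Fin d → ℝ} (hX : ∀ n, Measurable (X n))
    (h : ∀ l : Fin d → ℝ, Tendsto (fun n => ∫ ω, cexp (I * (∑ i, l i * X n ω i : ℝ)) ∂μ) atTop
      (𝓝 (cexp (-((∑ i, ∑ j, l i * S i j * l j) / 2 : ℝ))))) :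
    TendstoInDist μ X (centeredGaussian S) := by
  intro f
  have hto : Measurable (WithLp.toLp 2 : (Fin d → ℝ) → EuclideanSpace ℝ (Fin d)) :=
    WithLp.measurable_toLp ..
  have hof : Measurable (WithLp.ofLp : EuclideanSpace ℝ (Fin d) → Fin d → ℝ) :=
    WithLp.measurable_ofLp ..
  have hY : ∀ n, Measurable fun ω => WithLp.toLp 2 (X n ω) := fun n => hto.comp (hX n)
  let M : ℕ → ProbabilityMeasure (EuclideanSpace ℝ (Fin d)) := fun n =>
    ⟨μ.map fun ω => WithLp.toLp 2 (X n ω), Measure.isProbabilityMeasure_map (hY n).aemeasurable⟩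
  let M₀ : ProbabilityMeasure (EuclideanSpace ℝ (Fin d)) :=
    ⟨multivariateGaussian 0 S, inferInstance⟩
  have hM : Tendsto M atTop (𝓝 M₀) := by
    refine ProbabilityMeasure.tendsto_of_tendsto_charFun fun t => ?_
    have h1 : charFun (M₀ : Measure _) t =
        cexp (-((∑ i, ∑ j, t i * S i j * t j) / 2 : ℝ)) := by
      change charFun (multivariateGaussian 0 S) t = _
      rw [charFun_multivariateGaussian hS, dotProduct_mulVec_eq_sum]
      simp
    rw [h1]
    refine (h t).congr fun n => ?_
    change _ = charFun (μ.map fun ω => WithLp.toLp 2 (X n ω)) t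
    rw [charFun_apply, integral_map (hY n).aemeasurable (by fun_prop)]
    congr with ω
    rw [mul_comm, PiLp.inner_apply]
    simp
  have hf := (ProbabilityMeasure.tendsto_iff_forall_integral_tendsto.1 hM)
    (f.compContinuous ⟨WithLp.ofLp, PiLp.continuous_ofLp 2 _⟩)
  have h2 : ∫ x, f x ∂centeredGaussian S =
      ∫ x, f (WithLp.ofLp x) ∂(multivariateGaussian 0 S : Measure (EuclideanSpace ℝ (Fin d))) :=
    integral_map hof.aemeasurable f.continuous.aestronglyMeasurable
  rw [h2]
  refine hf.congr fun n => ?_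
  exact integral_map (hY n).aemeasurable
    (f.continuous.comp (PiLp.continuous_ofLp 2 _)).aestronglyMeasurable

section Covariance

variable {q : ℕ}

lemma cSigmaB_apply (hq : 1 ≤ q) (i j : Fin (6 * q)) :
    cSigmaB (6 * q) i j = (2 * ((vvec (6 * q) q i).re * (vvec (6 * q) q j).re +
      (vvec (6 * q) q i).im * (vvec (6 * q) q j).im) : ℝ) := by
  have h1 : 6 * q / 6 = q := by omega
  have h5 : 5 * (6 * q) / 6 = 6 * q - q := by omega
  rw [cSigmaB, Matrix.of_apply, h1, h5, vvec_sub (by omega), vvec_sub (by omega)]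
  apply Complex.ext
  · simp
    ring
  · simp
    ring

lemma rSigmaB_apply (hq : 1 ≤ q) (i j : Fin (6 * q)) :
    rSigmaB (6 * q) i j = 2 * ((vvec (6 * q) q i).re * (vvec (6 * q) q j).re +
      (vvec (6 * q) q i).im * (vvec (6 * q) q j).im) := by
  rw [rSigmaB, Matrix.of_apply, cSigmaB_apply hq, ofReal_re]

lemma sum_rSigmaB (hq : 1 ≤ q) (l : Fin (6 * q) → ℝ) :
    ∑ i, ∑ j, l i * rSigmaB (6 * q) i j * l j = 2 * ‖∑ i, (l i : ℂ) * vvec (6 * q) q i‖ ^ 2 := by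
  rw [Complex.sq_norm, normSq_apply, re_sum, im_sum]
  simp only [re_ofReal_mul, im_ofReal_mul]
  rw [Finset.sum_mul_sum, Finset.sum_mul_sum, ← Finset.sum_add_distrib, Finset.mul_sum]
  refine Finset.sum_congr rfl fun i _ => ?_
  rw [← Finset.sum_add_distrib, Finset.mul_sum]
  refine Finset.sum_congr rfl fun j _ => ?_
  rw [rSigmaB_apply hq]
  ring

/-- A square root of the covariance matrix. -/
def sigmaRoot (q : ℕ) : Matrix (Fin (6 * q)) (Fin 2) ℝ :=
  Matrix.of fun i => ![√2 * (vvec (6 * q) q i).re, √2 * (vvec (6 * q) q i).im]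

lemma rSigmaB_eq_mul_transpose (hq : 1 ≤ q) :
    rSigmaB (6 * q) = sigmaRoot q * (sigmaRoot q).transpose := by
  ext i j
  rw [rSigmaB_apply hq, Matrix.mul_apply, Fin.sum_univ_two]
  have h2 : √2 * √2 = (2 : ℝ) := Real.mul_self_sqrt zero_le_two
  simp only [sigmaRoot, Matrix.transpose_apply, Matrix.of_apply, Matrix.cons_val_zero,
    Matrix.cons_val_one]
  linear_combination -((vvec (6 * q) q i).re * (vvec (6 * q) q j).re +
      (vvec (6 * q) q i).im * (vvec (6 * q) q j).im) * h2

lemma posSemidef_rSigmaB (hq : 1 ≤ q) : (rSigmaB (6 * q)).PosSemidef := by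
  rw [rSigmaB_eq_mul_transpose hq, ← Matrix.conjTranspose_eq_transpose_of_trivial]
  exact Matrix.posSemidef_self_mul_conjTranspose _

lemma isSymm_rSigmaB (hq : 1 ≤ q) : (rSigmaB (6 * q)).IsSymm := by
  ext i j
  rw [Matrix.transpose_apply, rSigmaB_apply hq, rSigmaB_apply hq]
  ring

lemma rank_rSigmaB (hq : 1 ≤ q) : (rSigmaB (6 * q)).rank = 2 := by
  rw [rSigmaB_eq_mul_transpose hq, Matrix.rank_self_mul_transpose, ← Matrix.rank_transpose]
  have hm : ((6 * q : ℕ) : ℝ) ≠ 0 := by exact_mod_cast (by omega : 6 * q ≠ 0)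
  have him : (cw (6 * q) ^ q).im ≠ 0 := by
    intro h
    have h1 := norm_cw_pow (6 * q) q
    rw [← sq_eq_sq₀ (norm_nonneg _) zero_le_one, Complex.sq_norm, normSq_apply,
      re_cw_pow_eq_half hq, h] at h1
    norm_num at h1
  have hv0 : vvec (6 * q) q ⟨0, by omega⟩ = (((6 * q : ℕ) : ℝ)⁻¹ : ℝ) := by
    rw [vvec_eq]
    simp
  have hv1 : (vvec (6 * q) q ⟨1, by omega⟩).im ≠ 0 := by
    rw [vvec_eq, ← ofReal_natCast, ← ofReal_inv, im_ofReal_mul, conj_im, mul_one]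
    exact mul_ne_zero (inv_ne_zero hm) (neg_ne_zero.2 him)
  have h2 : (√2 : ℝ) ≠ 0 := by positivity
  have hli : LinearIndependent ℝ (sigmaRoot q).transpose.row := by
    rw [linearIndependent_fin2]
    refine ⟨fun h => ?_, fun a h => ?_⟩
    · have h1 := congrFun h ⟨1, by omega⟩
      simp [sigmaRoot, hv1] at h1
    · have h0 := congrFun h ⟨0, by omega⟩
      simp [sigmaRoot, hv0] at h0
      omega
  rw [hli.rank_matrix, Fintype.card_fin]

end Covariance

lemma norm_cexp_I_mul_sub_le (x y : ℝ) : ‖cexp (I * x) - cexp (I * y)‖ ≤ |x - y| := by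
  have h := Real.norm_exp_I_mul_ofReal_sub_one_le (x := x - y)
  have h2 : cexp (I * x) - cexp (I * y) = cexp (I * y) * (cexp (I * ((x - y : ℝ) : ℂ)) - 1) := by
    rw [mul_sub, ← Complex.exp_add, mul_one]
    congr 2
    push_cast
    ring
  rw [h2, norm_mul, mul_comm I (y : ℂ), norm_exp_ofReal_mul_I, one_mul]
  exact h

lemma norm_integral_cexp_sub_le {Ω : Type*} [MeasurableSpace Ω] {μ : Measure Ω}
    [IsProbabilityMeasure μ] {x y : Ω → ℝ} (hx : Measurable x) (hy : Measurable y)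
    (hxy : Integrable (fun ω => x ω - y ω) μ) :
    ‖∫ ω, cexp (I * x ω) ∂μ - ∫ ω, cexp (I * y ω) ∂μ‖ ≤ ∫ ω, |x ω - y ω| ∂μ := by
  have hint : ∀ {f : Ω → ℝ}, Measurable f → Integrable (fun ω => cexp (I * f ω)) μ := by
    intro f hf
    refine Integrable.of_bound (by fun_prop) 1 (Eventually.of_forall fun ω => le_of_eq ?_)
    rw [mul_comm, norm_exp_ofReal_mul_I]
  rw [← integral_sub (hint hx) (hint hy)]
  refine (norm_integral_le_integral_norm _).trans ?_
  exact integral_mono ((hint hx).sub (hint hy)).norm hxy.abs fun ω => norm_cexp_I_mul_sub_le _ _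

lemma tendsto_inv_sqrt_mul_log_mul_sqrt (K : ℝ) :
    Tendsto (fun n : ℕ => (√(n * Real.log n))⁻¹ * (K * √((n : ℝ) + 1))) atTop (𝓝 0) := by
  have hlog : Tendsto (fun N : ℕ => Real.log N) atTop atTop :=
    Real.tendsto_log_atTop.comp tendsto_natCast_atTop_atTop
  have h1 : Tendsto (fun n : ℕ => |K| * √(2 / Real.log n)) atTop (𝓝 0) := by
    have := ((tendsto_const_nhds (x := (2 : ℝ))).div_atTop hlog).sqrt.const_mul |K|
    simpa using this
  refine squeeze_zero_norm' ?_ h1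
  filter_upwards [eventually_ge_atTop 2] with n hn
  have hn0 : (1 : ℝ) ≤ n := by exact_mod_cast (by omega : 1 ≤ n)
  have hl : 0 < Real.log n := Real.log_pos (by exact_mod_cast hn)
  rw [mul_left_comm, norm_mul, Real.norm_eq_abs]
  gcongr
  rw [← Real.sqrt_inv, ← Real.sqrt_mul (by positivity), Real.norm_of_nonneg (Real.sqrt_nonneg _)]
  refine Real.sqrt_le_sqrt ?_
  rw [inv_mul_le_iff₀ (by positivity)]
  calc (n : ℝ) + 1 ≤ n * 2 := by linarith
    _ = _ := by field_simp

section Main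

variable {Ω : Type*} [MeasurableSpace Ω] {μ : Measure Ω} {q : ℕ} {j0 : Fin (6 * q)}
  {R : ℕ → Ω → Fin (6 * q) → ℝ}

/-- The urn composition after removal of the mean and the supercritical modes, normalized by
`√(n log n)`, converges to a centered Gaussian law. -/
lemma exists_tendstoInDist (hR : IsCyclicUrn μ (6 * q) j0 R) (hj : (j0 : ℕ) = 0) :
    ∃ Ξ : ℕ → Ω → ℂ, TendstoInDist μ (fun n ω i => (√(n * Real.log n))⁻¹ *
      (R n ω i - expVec μ (R n) i - ∑ k ∈ Finset.Ico 1 q,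
        2 * ((n : ℂ) ^ (cw (6 * q) ^ k) * Ξ k ω * vvec (6 * q) k i).re))
      (centeredGaussian (rSigmaB (6 * q))) := by
  have := hR.isProb
  have hq : 1 ≤ q := by have := j0.pos; omega
  obtain ⟨Ξ, hΞm, hΞi, K, hK⟩ := exists_supercritical_limits hR hj
  refine ⟨Ξ, ?_⟩
  have hRm : ∀ n i, Measurable fun ω => R n ω i := fun n i =>
    (measurable_pi_apply i).comp (hR.meas n)
  have hRi : ∀ n i, Integrable (fun ω => R n ω i) μ := fun n i =>
    urn_integrable hR n (continuous_apply i)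
  have hUm : ∀ n, Measurable fun ω => ucoef (6 * q) q (R n ω) := fun n =>
    (continuous_ucoef _ q).measurable.comp (hR.meas n)
  have hUi : ∀ n, Integrable (fun ω => ucoef (6 * q) q (R n ω)) μ := fun n =>
    urn_integrable hR n (continuous_ucoef _ q)
  have hΞm' := fun k => (hΞm k).measurable
  have hsup : ∀ (n : ℕ) i, Measurable fun ω => ∑ k ∈ Finset.Ico 1 q,
      2 * ((n : ℂ) ^ (cw (6 * q) ^ k) * Ξ k ω * vvec (6 * q) k i).re := fun n i =>
    Finset.measurable_sum _ fun k _ => by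
      have := hΞm' k
      exact (measurable_re.comp ((this.const_mul _).mul_const _)).const_mul 2
  have hsupi : ∀ (n : ℕ) i, Integrable (fun ω => ∑ k ∈ Finset.Ico 1 q,
      2 * ((n : ℂ) ^ (cw (6 * q) ^ k) * Ξ k ω * vvec (6 * q) k i).re) μ := fun n i =>
    integrable_finsetSum _ fun k _ => ((((hΞi k).const_mul _).mul_const _).re).const_mul 2
  have hDm : ∀ n i, Measurable fun ω => R n ω i - expVec μ (R n) i - ∑ k ∈ Finset.Ico 1 q,
      2 * ((n : ℂ) ^ (cw (6 * q) ^ k) * Ξ k ω * vvec (6 * q) k i).re := fun n i =>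
    ((hRm n i).sub_const _).sub (hsup n i)
  have hei : ∀ n i, Integrable (fun ω => R n ω i - expVec μ (R n) i - ∑ k ∈ Finset.Ico 1 q,
      2 * ((n : ℂ) ^ (cw (6 * q) ^ k) * Ξ k ω * vvec (6 * q) k i).re -
      2 * ((ucoef (6 * q) q (R n ω) - urnProd (cw (6 * q) ^ q) n) * vvec (6 * q) q i).re) μ :=
    fun n i => (((hRi n i).sub (integrable_const _)).sub (hsupi n i)).sub
      (((((hUi n).sub (integrable_const _)).mul_const _).re).const_mul 2)
  refine tendstoInDist_centeredGaussian (posSemidef_rSigmaB hq)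
    (fun n => measurable_pi_lambda _ fun i => (hDm n i).const_mul _) fun l => ?_
  set c : ℂ := ∑ i, (l i : ℂ) * vvec (6 * q) q i with hc
  have hz2 : (cw (6 * q) ^ (2 * q)).re < 1 / 2 := re_cw_pow_lt_half (by omega) (by omega)
  have hclt := tendsto_charFun_critical hR hj q (re_cw_pow_eq_half hq) hz2 (2 * c)
  have hlim : ‖2 * c‖ ^ 2 / 4 = (∑ i, ∑ j, l i * rSigmaB (6 * q) i j * l j) / 2 := by
    rw [sum_rSigmaB hq, norm_mul, mul_pow]
    norm_num
    ring
  rw [hlim] at hclt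
  refine tendsto_of_tendsto_of_dist hclt ?_
  refine squeeze_zero' (Eventually.of_forall fun n => dist_nonneg) ?_
    (tendsto_inv_sqrt_mul_log_mul_sqrt ((∑ i, |l i|) * K))
  filter_upwards [eventually_ge_atTop 1] with n hn
  rw [dist_comm, dist_eq_norm]
  set s : ℝ := (√(n * Real.log n))⁻¹ with hs
  have hs0 : 0 ≤ s := by positivity
  have hdiff : ∀ ω, ∑ i, l i * (s * (R n ω i - expVec μ (R n) i - ∑ k ∈ Finset.Ico 1 q,
      2 * ((n : ℂ) ^ (cw (6 * q) ^ k) * Ξ k ω * vvec (6 * q) k i).re)) -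
      s * (2 * c * (ucoef (6 * q) q (R n ω) - urnProd (cw (6 * q) ^ q) n)).re =
      ∑ i, s * l i * (R n ω i - expVec μ (R n) i - ∑ k ∈ Finset.Ico 1 q,
      2 * ((n : ℂ) ^ (cw (6 * q) ^ k) * Ξ k ω * vvec (6 * q) k i).re -
      2 * ((ucoef (6 * q) q (R n ω) - urnProd (cw (6 * q) ^ q) n) * vvec (6 * q) q i).re) := by
    intro ω
    set U := ucoef (6 * q) q (R n ω) - urnProd (cw (6 * q) ^ q) n with hU
    have h1 : (2 * c * U).re = ∑ i, l i * (2 * (U * vvec (6 * q) q i).re) := by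
      rw [hc, Finset.mul_sum, Finset.sum_mul, re_sum]
      refine Finset.sum_congr rfl fun i _ => ?_
      rw [← re_ofReal_mul, ← re_ofReal_mul]
      congr 1
      push_cast
      ring
    rw [h1, Finset.mul_sum, ← Finset.sum_sub_distrib]
    exact Finset.sum_congr rfl fun i _ => by ring
  have hym : Measurable fun ω =>
      s * (2 * c * (ucoef (6 * q) q (R n ω) - urnProd (cw (6 * q) ^ q) n)).re :=
    (measurable_re.comp (((hUm n).sub_const _).const_mul (2 * c))).const_mul s
  refine (norm_integral_cexp_sub_le
    (Finset.measurable_sum _ fun i _ => ((hDm n i).const_mul s).const_mul (l i)) hym ?_).trans ?_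
  · simp only [hdiff]
    exact integrable_finsetSum _ fun i _ => (hei n i).const_mul _
  · simp only [hdiff]
    calc _ ≤ ∫ ω, ∑ i, s * |l i| * |R n ω i - expVec μ (R n) i - ∑ k ∈ Finset.Ico 1 q,
          2 * ((n : ℂ) ^ (cw (6 * q) ^ k) * Ξ k ω * vvec (6 * q) k i).re -
          2 * ((ucoef (6 * q) q (R n ω) - urnProd (cw (6 * q) ^ q) n) *
            vvec (6 * q) q i).re| ∂μ := by
          refine integral_mono (integrable_finsetSum _ fun i _ => (hei n i).const_mul _).abs
            (integrable_finsetSum _ fun i _ => (hei n i).abs.const_mul _) fun ω => ?_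
          refine (Finset.abs_sum_le_sum_abs _ _).trans (Finset.sum_le_sum fun i _ => ?_)
          rw [abs_mul, abs_mul, abs_of_nonneg hs0]
      _ = ∑ i, s * |l i| * ∫ ω, |R n ω i - expVec μ (R n) i - ∑ k ∈ Finset.Ico 1 q,
          2 * ((n : ℂ) ^ (cw (6 * q) ^ k) * Ξ k ω * vvec (6 * q) k i).re -
          2 * ((ucoef (6 * q) q (R n ω) - urnProd (cw (6 * q) ^ q) n) *
            vvec (6 * q) q i).re| ∂μ := by
          rw [integral_finsetSum _ fun i _ => (hei n i).abs.const_mul _]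
          simp only [integral_const_mul]
      _ ≤ ∑ i, s * |l i| * (K * √((n : ℝ) + 1)) := by
          gcongr with i
          exact hK n hn i
      _ = s * ((∑ i, |l i|) * K * √((n : ℝ) + 1)) := by
          rw [← Finset.sum_mul, ← Finset.mul_sum]
          ring

end Main

theorem stmt1 {Ω : Type*} [MeasurableSpace Ω] (μ : Measure Ω) (m : ℕ) (hm : 2 ≤ m)
    (h6 : 6 ∣ m) (R : ℕ → Ω → Fin m → ℝ)
    (hR : IsCyclicUrn μ m ⟨0, by omega⟩ R) :
    ∃ Ξ : ℕ → Ω → ℂ, ∃ ν : Measure (Fin m → ℝ),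
      (∀ i j, (cSigmaB m i j).im = 0) ∧
      (rSigmaB m).IsSymm ∧ (rSigmaB m).PosSemidef ∧ (rSigmaB m).rank = 2 ∧
      IsCenteredGaussian ν (rSigmaB m) ∧
      TendstoInDist μ
        (fun n ω i => (Real.sqrt (n * Real.log n))⁻¹ *
          (R n ω i - expVec μ (R n) i -
            ∑ k ∈ Finset.Icc 1 ((m - 1) / 6),
              2 * ((n : ℂ) ^ (cw m ^ k) * Ξ k ω * vvec m k i).re)) ν := by
  obtain ⟨q, rfl⟩ := h6
  have hq : 1 ≤ q := by omega
  obtain ⟨Ξ, hΞ⟩ := exists_tendstoInDist hR rfl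
  have hI : Finset.Icc 1 ((6 * q - 1) / 6) = Finset.Ico 1 q := by
    ext k
    simp only [Finset.mem_Icc, Finset.mem_Ico]
    omega
  refine ⟨Ξ, centeredGaussian (rSigmaB (6 * q)), fun i j => ?_, isSymm_rSigmaB hq,
    posSemidef_rSigmaB hq, rank_rSigmaB hq,
    isCenteredGaussian_centeredGaussian (posSemidef_rSigmaB hq), ?_⟩
  · rw [cSigmaB_apply hq, ofReal_im]
  · rw [hI]
    exact hΞ

end
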